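/- Let (u, ρ) be a smooth solution of the prescribed curvature flow on [0, T) for smooth positive data f (on the closed unit disc) and j (on the unit circle), with K = e^{−2u}(−Δu) in B and k = e^{−u}(∂u/∂ν₀ + 1) on ∂B. Suppose α₁, β₁ are constants with α(t) ≤ α₁ and β(t) ≤ β₁ for all t < T, let m₀ = ½∫_B e^{2u(·,0)} dz + ∫_{∂B} e^{u(·,0)} ds₀, and let C₁, C₂ ∈ (0, ∞) satisfy C₁ ≥ sup_{t<T} max{ α(t)|ρ'(t)|ρ(t)^{−1}‖f‖_{L∞}, α(t)²ρ(t)^{−1}‖f‖²_{L∞} } and C₂ ≥ sup_{t<T} max{ 2β(t)|ρ'(t)|(π−ρ(t))^{−1}‖j‖_{L∞}, β(t)²(π−ρ(t))^{−1}‖j‖²_{L∞} }. Then for every constant κ < 0 satisfying κ < −2( sup_B |K(·,0)| + α₁‖f‖_{L∞} + β₁‖j‖_{L∞} ) and κ² − C_i + 2 m₀ C_i κ > 0 for i = 1, 2, there holds, for every t < T, inf_{∂B}( k(·,t) − β(t) j ) ≥ inf_B( K(·,t) − α(t) f ) ≥ κ. -/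

import Mathlib

open MeasureTheory Metric Set Filter
open scoped Real Topology ENNReal

noncomputable section

/-- The closed unit disc in `ℂ ≅ ℝ²`. -/
def cdisc : Set ℂ := Metric.closedBall 0 1

/-- The open unit disc `B`. -/
def odisc : Set ℂ := Metric.ball 0 1

/-- The unit circle `∂B`. -/
def bdry : Set ℂ := Metric.sphere 0 1

/-- The boundary point with angle `θ`. -/
def bpt (θ : ℝ) : ℂ := Complex.exp ((θ : ℂ) * Complex.I)

/-- Boundary integral with respect to arclength `ds₀`. -/
def circInt (φ : ℂ → ℝ) : ℝ := ∫ θ in (0:ℝ)..(2 * Real.pi), φ (bpt θ)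

/-- Integral over the open unit disc with respect to Lebesgue measure. -/
def ballInt (φ : ℂ → ℝ) : ℝ := ∫ z in odisc, φ z

/-- Outward normal derivative `∂w/∂ν₀(z) = z·∇w(z)` for `z ∈ ∂B`. -/
def nder (w : ℂ → ℝ) (z : ℂ) : ℝ := fderivWithin ℝ w cdisc z z

/-- The Euclidean Laplacian, computed with derivatives within the closed disc. -/
def lapW (w : ℂ → ℝ) (z : ℂ) : ℝ :=
  fderivWithin ℝ (fun x => fderivWithin ℝ w cdisc x 1) cdisc z 1 +
  fderivWithin ℝ (fun x => fderivWithin ℝ w cdisc x Complex.I) cdisc z Complex.I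

/-- The coefficient `α(t) = 2ρ(t)/∫_B f e^{2u(·,t)} dz`. -/
def alphaC (f : ℂ → ℝ) (u : ℂ → ℝ → ℝ) (ρ : ℝ → ℝ) (t : ℝ) : ℝ :=
  2 * ρ t / ballInt fun z => f z * Real.exp (2 * u z t)

/-- The coefficient `β(t) = 2(π − ρ(t))/∫_{∂B} j e^{u(·,t)} ds₀`. -/
def betaC (j : ℂ → ℝ) (u : ℂ → ℝ → ℝ) (ρ : ℝ → ℝ) (t : ℝ) : ℝ :=
  2 * (Real.pi - ρ t) / circInt fun z => j z * Real.exp (u z t)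

/-- The time domain `[0, T)` (with `T ∈ (0, ∞]`). -/
def flowDom (T : ℝ≥0∞) : Set ℝ := {t : ℝ | 0 ≤ t ∧ ENNReal.ofReal t < T}

/-- `(u, ρ)` is a smooth solution of the prescribed curvature flow on `[0, T)`:
`∂u/∂t = α f + e^{−2u} Δu` in `B`, `∂u/∂t = β j − e^{−u}(∂u/∂ν₀ + 1)` on `∂B`,
and `dρ/dt = log (β²/α)`, with `u` smooth on `closure B × [0,T)` and `ρ` C¹ with
values in `(0, π)`. -/
def IsFlow (f j : ℂ → ℝ) (T : ℝ≥0∞) (u : ℂ → ℝ → ℝ) (ρ : ℝ → ℝ) : Prop :=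
  ContDiffOn ℝ (⊤ : ℕ∞) (fun p : ℂ × ℝ => u p.1 p.2) (cdisc ×ˢ flowDom T) ∧
  ContDiffOn ℝ 1 ρ (flowDom T) ∧
  (∀ t ∈ flowDom T, ρ t ∈ Set.Ioo 0 Real.pi) ∧
  (∀ t ∈ flowDom T, 0 < t → ∀ z ∈ odisc,
    deriv (u z) t = alphaC f u ρ t * f z + Real.exp (-(2 * u z t)) * lapW (fun w => u w t) z) ∧
  (∀ t ∈ flowDom T, 0 < t → ∀ z ∈ bdry,
    deriv (u z) t = betaC j u ρ t * j z - Real.exp (-(u z t)) * (nder (fun w => u w t) z + 1)) ∧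
  (∀ t ∈ flowDom T, 0 < t →
    deriv ρ t = Real.log (betaC j u ρ t ^ 2 / alphaC f u ρ t))

/-- Gauss curvature `K = e^{−2u}(−Δu)` of the evolving metric. -/
def Kcur (u : ℂ → ℝ → ℝ) (t : ℝ) (z : ℂ) : ℝ :=
  Real.exp (-(2 * u z t)) * (- lapW (fun w => u w t) z)

/-- Boundary geodesic curvature `k = e^{−u}(∂u/∂ν₀ + 1)` of the evolving metric. -/
def kcur (u : ℂ → ℝ → ℝ) (t : ℝ) (z : ℂ) : ℝ :=
  Real.exp (-(u z t)) * (nder (fun w => u w t) z + 1)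

/-- The parabolic domain `closure B × [0, T)`. -/
def spaceTime (T : ℝ≥0∞) : Set (ℂ × ℝ) := cdisc ×ˢ flowDom T

/-- Directional derivative in direction `e` within the parabolic domain. -/
def dirD (T : ℝ≥0∞) (e : ℂ × ℝ) (F : ℂ × ℝ → ℝ) (p : ℂ × ℝ) : ℝ :=
  fderivWithin ℝ F (spaceTime T) p e

lemma isCompact_cdisc : IsCompact cdisc := isCompact_closedBall 0 1

lemma isCompact_bdry : IsCompact bdry := isCompact_sphere 0 1

lemma odisc_subset_cdisc : odisc ⊆ cdisc := ball_subset_closedBall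

lemma bdry_subset_cdisc : bdry ⊆ cdisc := sphere_subset_closedBall

lemma closure_odisc : closure odisc = cdisc := closure_ball 0 one_ne_zero

lemma mem_odisc_or_mem_bdry {z : ℂ} (hz : z ∈ cdisc) : z ∈ odisc ∨ z ∈ bdry := by
  have h : ‖z‖ ≤ 1 := by simpa [cdisc] using hz
  rcases h.lt_or_eq with h | h
  · left; simpa [odisc] using h
  · right; simpa [bdry] using h

lemma cdisc_mem_nhds {z : ℂ} (hz : z ∈ odisc) : cdisc ∈ 𝓝 z :=
  mem_of_superset (isOpen_ball.mem_nhds hz) odisc_subset_cdisc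

lemma convex_cdisc : Convex ℝ cdisc := convex_closedBall 0 1

lemma interior_cdisc_nonempty : (interior cdisc).Nonempty :=
  ⟨0, mem_interior_iff_mem_nhds.2 (cdisc_mem_nhds (by simp [odisc]))⟩

lemma uniqueDiffOn_cdisc : UniqueDiffOn ℝ cdisc :=
  uniqueDiffOn_convex convex_cdisc interior_cdisc_nonempty

lemma zero_mem_flowDom {T : ℝ≥0∞} (hT : 0 < T) : (0 : ℝ) ∈ flowDom T := by
  simpa [flowDom] using hT

lemma mem_flowDom_of_le {T : ℝ≥0∞} {s t : ℝ} (ht : t ∈ flowDom T) (hs : 0 ≤ s) (hst : s ≤ t) :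
    s ∈ flowDom T :=
  ⟨hs, (ENNReal.ofReal_le_ofReal hst).trans_lt ht.2⟩

lemma convex_flowDom (T : ℝ≥0∞) : Convex ℝ (flowDom T) := by
  refine OrdConnected.convex ⟨fun a ha b hb x hx => ?_⟩
  exact mem_flowDom_of_le hb (ha.1.trans hx.1) hx.2

lemma exists_gt_mem_flowDom {T : ℝ≥0∞} {t : ℝ} (ht : t ∈ flowDom T) :
    ∃ b ∈ flowDom T, t < b := by
  obtain ⟨r, hr₁, hr₂⟩ := ENNReal.lt_iff_exists_nnreal_btwn.1 ht.2
  refine ⟨r, ⟨r.2, by simpa using hr₂⟩, ?_⟩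
  rw [ENNReal.ofReal, ENNReal.coe_lt_coe] at hr₁
  exact (Real.le_coe_toNNReal t).trans_lt (by exact_mod_cast hr₁)

lemma flowDom_mem_nhds {T : ℝ≥0∞} {t : ℝ} (ht : t ∈ flowDom T) (h0 : 0 < t) :
    flowDom T ∈ 𝓝 t := by
  obtain ⟨b, hb, htb⟩ := exists_gt_mem_flowDom ht
  exact mem_of_superset (Ioo_mem_nhds h0 htb) fun s hs => mem_flowDom_of_le hb hs.1.le hs.2.le

lemma interior_flowDom_nonempty {T : ℝ≥0∞} (hT : 0 < T) : (interior (flowDom T)).Nonempty := by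
  obtain ⟨b, hb, h0⟩ := exists_gt_mem_flowDom (zero_mem_flowDom hT)
  exact ⟨b, mem_interior_iff_mem_nhds.2 (flowDom_mem_nhds hb h0)⟩

lemma uniqueDiffOn_spaceTime {T : ℝ≥0∞} (hT : 0 < T) : UniqueDiffOn ℝ (spaceTime T) :=
  uniqueDiffOn_cdisc.prod (uniqueDiffOn_convex (convex_flowDom T) (interior_flowDom_nonempty hT))

lemma spaceTime_subset_closure_interior {T : ℝ≥0∞} (hT : 0 < T) :
    spaceTime T ⊆ closure (interior (spaceTime T)) := by
  rw [Convex.closure_interior_eq_closure_of_nonempty_interior (𝕜 := ℝ)]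
  · exact subset_closure
  · exact convex_cdisc.prod (convex_flowDom T)
  · rw [spaceTime, interior_prod_eq]
    exact interior_cdisc_nonempty.prod (interior_flowDom_nonempty hT)

lemma contDiffOn_dirD {T : ℝ≥0∞} (hT : 0 < T) {F : ℂ × ℝ → ℝ}
    (hF : ContDiffOn ℝ (⊤ : ℕ∞) F (spaceTime T)) (e : ℂ × ℝ) :
    ContDiffOn ℝ (⊤ : ℕ∞) (dirD T e F) (spaceTime T) :=
  (hF.fderivWithin (uniqueDiffOn_spaceTime hT) (by simp)).clm_apply contDiffOn_const

lemma dirD_comm {T : ℝ≥0∞} (hT : 0 < T) {F : ℂ × ℝ → ℝ}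
    (hF : ContDiffOn ℝ (⊤ : ℕ∞) F (spaceTime T)) (e e' : ℂ × ℝ) {p : ℂ × ℝ}
    (hp : p ∈ spaceTime T) :
    dirD T e (dirD T e' F) p = dirD T e' (dirD T e F) p := by
  have hu := uniqueDiffOn_spaceTime hT
  have hd : DifferentiableWithinAt ℝ (fderivWithin ℝ F (spaceTime T)) (spaceTime T) p :=
    (hF.fderivWithin (m := (⊤ : ℕ∞)) hu (by simp)).differentiableOn (by simp) p hp
  have key : ∀ a b : ℂ × ℝ, dirD T a (dirD T b F) p =
      fderivWithin ℝ (fderivWithin ℝ F (spaceTime T)) (spaceTime T) p a b := by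
    intro a b
    have h : fderivWithin ℝ (fun q => fderivWithin ℝ F (spaceTime T) q b) (spaceTime T) p = _ :=
      fderivWithin_clm_apply (hu p hp) hd (differentiableWithinAt_const b)
    unfold dirD
    rw [h]
    simp
  rw [key, key]
  exact (hF p hp).isSymmSndFDerivWithinAt
    (by simpa using! WithTop.coe_le_coe.2 (le_top (a := (2 : ℕ∞)))) hu
    (spaceTime_subset_closure_interior hT hp) hp _ _

lemma hasFDerivWithinAt_slice {T : ℝ≥0∞} {F : ℂ × ℝ → ℝ}
    (hF : ContDiffOn ℝ (⊤ : ℕ∞) F (spaceTime T)) {z : ℂ} {t : ℝ} (hz : z ∈ cdisc)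
    (ht : t ∈ flowDom T) :
    HasFDerivWithinAt (fun w => F (w, t))
      ((fderivWithin ℝ F (spaceTime T) (z, t)).comp (ContinuousLinearMap.inl ℝ ℂ ℝ)) cdisc z := by
  have h := ((hF.differentiableOn (by simp)) (z, t) ⟨hz, ht⟩).hasFDerivWithinAt
  exact HasFDerivWithinAt.comp z h (hasFDerivAt_prodMk_left z t).hasFDerivWithinAt
    fun w hw => mk_mem_prod hw ht

lemma fderivWithin_slice {T : ℝ≥0∞} {F : ℂ × ℝ → ℝ}
    (hF : ContDiffOn ℝ (⊤ : ℕ∞) F (spaceTime T)) {z : ℂ} {t : ℝ} (hz : z ∈ cdisc)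
    (ht : t ∈ flowDom T) (e : ℂ) :
    fderivWithin ℝ (fun w => F (w, t)) cdisc z e = dirD T (e, 0) F (z, t) := by
  rw [(hasFDerivWithinAt_slice hF hz ht).fderivWithin (uniqueDiffOn_cdisc z hz)]
  simp [dirD]

lemma lapW_slice {T : ℝ≥0∞} (hT : 0 < T) {F : ℂ × ℝ → ℝ}
    (hF : ContDiffOn ℝ (⊤ : ℕ∞) F (spaceTime T)) {z : ℂ} {t : ℝ} (hz : z ∈ cdisc)
    (ht : t ∈ flowDom T) :
    lapW (fun w => F (w, t)) z = dirD T (1, 0) (dirD T (1, 0) F) (z, t) +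
      dirD T (Complex.I, 0) (dirD T (Complex.I, 0) F) (z, t) := by
  have key : ∀ e : ℂ, fderivWithin ℝ (fun x => fderivWithin ℝ (fun w => F (w, t)) cdisc x e)
      cdisc z e = dirD T (e, 0) (dirD T (e, 0) F) (z, t) := by
    intro e
    rw [← fderivWithin_slice (contDiffOn_dirD hT hF _) hz ht,
      fderivWithin_congr (fun x hx => fderivWithin_slice hF hx ht e)
        (fderivWithin_slice hF hz ht e)]
  rw [lapW, key, key]

lemma hasDerivAt_slice {T : ℝ≥0∞} {F : ℂ × ℝ → ℝ}
    (hF : ContDiffOn ℝ (⊤ : ℕ∞) F (spaceTime T)) {z : ℂ} {t : ℝ} (hz : z ∈ cdisc)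
    (ht : t ∈ flowDom T) (h0 : 0 < t) :
    HasDerivAt (fun s => F (z, s)) (dirD T (0, 1) F (z, t)) t := by
  have h := ((hF.differentiableOn (by simp)) (z, t) ⟨hz, ht⟩).hasFDerivWithinAt
  have h2 : HasFDerivWithinAt (fun s => F (z, s)) _ (flowDom T) t :=
    HasFDerivWithinAt.comp t h (hasFDerivAt_prodMk_right z t).hasFDerivWithinAt
      fun w hw => mk_mem_prod hz hw
  have h3 := (h2.hasFDerivAt (flowDom_mem_nhds ht h0)).hasDerivAt
  simpa [dirD] using h3

section ParametricIntegrals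

variable {X : Type*} [MeasurableSpace X] {μ : Measure X} [IsFiniteMeasure μ] {γ : X → ℂ}
  {A : Set ℂ}

lemma integrable_comp_of_continuousOn (hγ : Measurable γ) (hA : IsCompact A)
    (hγA : ∀ᵐ x ∂μ, γ x ∈ A) {φ : ℂ → ℝ} (hφ : ContinuousOn φ A) :
    Integrable (fun x => φ (γ x)) μ := by
  classical
  obtain ⟨C, hC⟩ := hA.exists_bound_of_continuousOn hφ
  refine Integrable.of_bound (C := C) ?_ (hγA.mono fun x hx => hC _ hx)
  have hm : Measurable (A.piecewise φ 0) :=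
    hφ.measurable_piecewise continuousOn_const hA.measurableSet
  refine (hm.comp hγ).aestronglyMeasurable.congr ?_
  filter_upwards [hγA] with x hx
  simp [hx]

lemma integral_comp_pos (hγ : Measurable γ) (hA : IsCompact A)
    (hγA : ∀ᵐ x ∂μ, γ x ∈ A) (hμ : μ ≠ 0) {φ : ℂ → ℝ} (hφ : ContinuousOn φ A)
    (hpos : ∀ z ∈ A, 0 < φ z) : 0 < ∫ x, φ (γ x) ∂μ := by
  refine (integral_pos_iff_support_of_nonneg_ae (hγA.mono fun x hx => (hpos _ hx).le)
    (integrable_comp_of_continuousOn hγ hA hγA hφ)).2 (pos_iff_ne_zero.2 fun h0 => hμ ?_)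
  rw [← Measure.measure_univ_eq_zero, ← h0]
  refine measure_congr ?_
  filter_upwards [hγA] with x hx
  exact propext ⟨fun _ => (hpos _ hx).ne', fun _ => trivial⟩

lemma hasDerivAt_integral_slice {T : ℝ≥0∞} (hT : 0 < T) (hγ : Measurable γ) (hA : IsCompact A)
    (hAc : A ⊆ cdisc) (hγA : ∀ᵐ x ∂μ, γ x ∈ A) {h : ℂ → ℝ} (hh : ContinuousOn h A)
    {G : ℂ × ℝ → ℝ} (hG : ContDiffOn ℝ (⊤ : ℕ∞) G (spaceTime T)) {t : ℝ}
    (ht : t ∈ flowDom T) (h0 : 0 < t) :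
    HasDerivAt (fun s => ∫ x, h (γ x) * G (γ x, s) ∂μ)
      (∫ x, h (γ x) * dirD T (0, 1) G (γ x, t) ∂μ) t := by
  obtain ⟨b, hb, htb⟩ := exists_gt_mem_flowDom ht
  have hsub : ∀ s ∈ Icc (t / 2) b, s ∈ flowDom T := fun s hs =>
    mem_flowDom_of_le hb (by linarith [hs.1]) hs.2
  have hD := contDiffOn_dirD hT hG (0, 1)
  have hcont : ∀ {F : ℂ × ℝ → ℝ}, ContDiffOn ℝ (⊤ : ℕ∞) F (spaceTime T) → ∀ s ∈ flowDom T,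
      ContinuousOn (fun z => h z * F (z, s)) A := fun {F} hF s hs =>
    hh.mul (hF.continuousOn.comp (by fun_prop) fun z hz => mk_mem_prod (hAc hz) hs)
  have hcont₂ : ContinuousOn (fun p : ℂ × ℝ => h p.1 * dirD T (0, 1) G p)
      (A ×ˢ Icc (t / 2) b) :=
    (hh.comp continuousOn_fst fun p hp => hp.1).mul
      (hD.continuousOn.mono (prod_mono hAc hsub))
  obtain ⟨C, hC⟩ := (hA.prod isCompact_Icc).exists_bound_of_continuousOn hcont₂
  have hnhds : Icc (t / 2) b ∈ 𝓝 t := Icc_mem_nhds (by linarith) htb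
  refine (hasDerivAt_integral_of_dominated_loc_of_deriv_le (μ := μ)
    (F := fun s x => h (γ x) * G (γ x, s)) (F' := fun s x => h (γ x) * dirD T (0, 1) G (γ x, s))
    (bound := fun _ => C) hnhds ?_ ?_ ?_ ?_ (integrable_const C) ?_).2
  · filter_upwards [hnhds] with s hs
    exact (integrable_comp_of_continuousOn hγ hA hγA (hcont hG s (hsub s hs))).1
  · exact integrable_comp_of_continuousOn hγ hA hγA (hcont hG t ht)
  · exact (integrable_comp_of_continuousOn hγ hA hγA (hcont hD t ht)).1
  · filter_upwards [hγA] with x hx s hs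
    exact hC (γ x, s) (mk_mem_prod hx hs)
  · filter_upwards [hγA] with x hx s hs
    exact (hasDerivAt_slice hG (hAc hx) (hsub s hs) (by linarith [hs.1])).const_mul _

lemma continuousWithinAt_integral_slice {T : ℝ≥0∞} (hγ : Measurable γ) (hA : IsCompact A)
    (hAc : A ⊆ cdisc) (hγA : ∀ᵐ x ∂μ, γ x ∈ A) {h : ℂ → ℝ} (hh : ContinuousOn h A)
    {G : ℂ × ℝ → ℝ} (hG : ContinuousOn G (spaceTime T)) {t : ℝ} (ht : t ∈ flowDom T) :
    ContinuousWithinAt (fun s => ∫ x, h (γ x) * G (γ x, s) ∂μ) (flowDom T) t := by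
  obtain ⟨b, hb, htb⟩ := exists_gt_mem_flowDom ht
  have hsub : ∀ s ∈ Icc 0 b, s ∈ flowDom T := fun s hs => mem_flowDom_of_le hb hs.1 hs.2
  have hcont : ContinuousOn (fun p : ℂ × ℝ => h p.1 * G p) (A ×ˢ flowDom T) :=
    (hh.comp continuousOn_fst fun p hp => hp.1).mul (hG.mono (prod_mono hAc subset_rfl))
  obtain ⟨C, hC⟩ := (hA.prod isCompact_Icc).exists_bound_of_continuousOn
    (hcont.mono (prod_mono subset_rfl hsub))
  have hev : ∀ᶠ s in 𝓝[flowDom T] t, s ∈ Icc 0 b := by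
    filter_upwards [self_mem_nhdsWithin, mem_nhdsWithin_of_mem_nhds (Iio_mem_nhds htb)]
      with s hs hsb
    exact ⟨hs.1, le_of_lt hsb⟩
  refine continuousWithinAt_of_dominated (bound := fun _ => C) ?_ ?_ (integrable_const C) ?_
  · filter_upwards [hev] with s hs
    exact (integrable_comp_of_continuousOn hγ hA hγA (φ := fun z => h z * G (z, s))
      (hcont.comp (by fun_prop) fun z hz => mk_mem_prod hz (hsub s hs))).1
  · filter_upwards [hev] with s hs
    filter_upwards [hγA] with x hx
    exact hC (γ x, s) (mk_mem_prod hx hs)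
  · filter_upwards [hγA] with x hx
    exact (hcont.comp (f := fun s => (γ x, s)) (by fun_prop)
      fun s hs => mk_mem_prod hx hs) t ht

end ParametricIntegrals

section Divergence

/-- The polar parametrization `(r, θ) ↦ r e^{iθ}` of the plane. -/
def polarPt (p : ℝ × ℝ) : ℂ := p.1 * (Real.cos p.2 + Real.sin p.2 * Complex.I)

lemma continuous_polarPt : Continuous polarPt := by unfold polarPt; fun_prop

lemma norm_polarPt (p : ℝ × ℝ) : ‖polarPt p‖ = |p.1| := by
  simp [polarPt, Complex.norm_cos_add_sin_mul_I]

lemma bpt_eq_polarPt (θ : ℝ) : bpt θ = polarPt (1, θ) := by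
  simp [bpt, polarPt, Complex.exp_mul_I]

lemma ballInt_eq_polar (φ : ℂ → ℝ) :
    ballInt φ = ∫ p in Icc ((0 : ℝ), -π) (1, π), p.1 * φ (polarPt p) := by
  have hs : MeasurableSet odisc := measurableSet_ball
  have hio : (Ioo (0 : ℝ) 1 ×ˢ Ioo (-π) π : Set (ℝ × ℝ)) =ᵐ[volume] Icc ((0 : ℝ), -π) (1, π) := by
    rw [← Icc_prod_Icc]
    exact Measure.set_prod_ae_eq Ioo_ae_eq_Icc Ioo_ae_eq_Icc
  rw [ballInt, ← integral_indicator hs, ← Complex.integral_comp_polarCoord_symm,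
    ← setIntegral_congr_set hio, polarCoord_target]
  have hmeas : MeasurableSet (Ioo (0 : ℝ) 1 ×ˢ Ioo (-π) π : Set (ℝ × ℝ)) :=
    measurableSet_Ioo.prod measurableSet_Ioo
  have hmeas₂ : MeasurableSet (Ioi (0 : ℝ) ×ˢ Ioo (-π) π : Set (ℝ × ℝ)) :=
    measurableSet_Ioi.prod measurableSet_Ioo
  rw [← integral_indicator hmeas, ← integral_indicator hmeas₂]
  congr 1 with p
  have hpt : ∀ q, Complex.polarCoord.symm q = polarPt q := fun q => by simp [polarPt]
  simp_rw [hpt]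
  have hmem : polarPt p ∈ odisc ↔ |p.1| < 1 := by simp [odisc, norm_polarPt]
  by_cases hp : p ∈ (Ioi (0 : ℝ) ×ˢ Ioo (-π) π : Set (ℝ × ℝ))
  · by_cases h1 : p.1 < 1
    · have hp' : p ∈ (Ioo (0 : ℝ) 1 ×ˢ Ioo (-π) π : Set (ℝ × ℝ)) := ⟨⟨hp.1, h1⟩, hp.2⟩
      have : polarPt p ∈ odisc := hmem.2 (by rwa [abs_of_pos hp.1])
      simp [indicator_of_mem, hp, hp', this]
    · have hp' : p ∉ (Ioo (0 : ℝ) 1 ×ˢ Ioo (-π) π : Set (ℝ × ℝ)) := fun h => h1 h.1.2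
      have : polarPt p ∉ odisc := fun h => h1 (abs_lt.1 (hmem.1 h)).2
      simp [indicator_of_notMem, hp', this]
  · have hp' : p ∉ (Ioo (0 : ℝ) 1 ×ˢ Ioo (-π) π : Set (ℝ × ℝ)) := fun h => hp ⟨h.1.1, h.2⟩
    rw [indicator_of_notMem hp, indicator_of_notMem hp']

lemma circInt_eq (φ : ℂ → ℝ) : circInt φ = ∫ θ in -π..π, φ (bpt θ) := by
  have hper : Function.Periodic (fun θ => φ (bpt θ)) (2 * π) := by
    intro θ
    simp only [bpt]
    congr 1
    rw [Complex.exp_eq_exp_iff_exists_int]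
    exact ⟨1, by push_cast; ring⟩
  have := hper.intervalIntegral_add_eq 0 (-π)
  rw [zero_add, show -π + 2 * π = π by ring] at this
  exact this

lemma apply_eq_re_im (L : ℂ →L[ℝ] ℝ) (z : ℂ) : L z = z.re * L 1 + z.im * L Complex.I := by
  conv_lhs => rw [← Complex.re_add_im z]
  have h1 : ((z.re : ℂ)) = z.re • (1 : ℂ) := by simp
  have h2 : ((z.im : ℂ)) * Complex.I = z.im • Complex.I := by simp
  rw [h1, h2, map_add, map_smul, map_smul, smul_eq_mul, smul_eq_mul]

/-- The divergence theorem on the unit disc. -/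
lemma integral_divergence_disc {P Q : ℂ → ℝ} (hP : ContDiffOn ℝ 1 P cdisc)
    (hQ : ContDiffOn ℝ 1 Q cdisc) :
    ballInt (fun z => fderivWithin ℝ P cdisc z 1 + fderivWithin ℝ Q cdisc z Complex.I) =
      circInt (fun z => z.re * P z + z.im * Q z) := by
  set dv : ℂ → ℝ := fun z => fderivWithin ℝ P cdisc z 1 + fderivWithin ℝ Q cdisc z Complex.I
    with hdv
  have hdvc : ContinuousOn dv cdisc :=
    ((hP.continuousOn_fderivWithin uniqueDiffOn_cdisc le_rfl).clm_apply continuousOn_const).add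
      ((hQ.continuousOn_fderivWithin uniqueDiffOn_cdisc le_rfl).clm_apply continuousOn_const)
  set F : ℝ × ℝ → ℝ := fun p =>
    p.1 * (Real.cos p.2 * P (polarPt p) + Real.sin p.2 * Q (polarPt p)) with hF
  set G : ℝ × ℝ → ℝ := fun p =>
    -(Real.sin p.2 * P (polarPt p)) + Real.cos p.2 * Q (polarPt p) with hG
  have hmaps : MapsTo polarPt (Icc ((0 : ℝ), -π) (1, π)) cdisc := by
    intro p hp
    have h0 : (0 : ℝ) ≤ p.1 := hp.1.1
    have h1 : p.1 ≤ 1 := hp.2.1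
    simpa [cdisc, norm_polarPt, abs_of_nonneg h0] using h1
  have hPc : ContinuousOn (fun p => P (polarPt p)) (Icc ((0 : ℝ), -π) (1, π)) :=
    hP.continuousOn.comp continuous_polarPt.continuousOn hmaps
  have hQc : ContinuousOn (fun p => Q (polarPt p)) (Icc ((0 : ℝ), -π) (1, π)) :=
    hQ.continuousOn.comp continuous_polarPt.continuousOn hmaps
  have hcos : ContinuousOn (fun p : ℝ × ℝ => Real.cos p.2) (Icc ((0 : ℝ), -π) (1, π)) := by
    fun_prop
  have hsin : ContinuousOn (fun p : ℝ × ℝ => Real.sin p.2) (Icc ((0 : ℝ), -π) (1, π)) := by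
    fun_prop
  have hin : ∀ p ∈ Ioo (0 : ℝ) 1 ×ˢ Ioo (-π) π, polarPt p ∈ odisc := by
    intro p hp
    have h0 : (0 : ℝ) < p.1 := hp.1.1
    simpa [odisc, norm_polarPt, abs_of_pos h0] using hp.1.2
  have hfd : ∀ {R : ℂ → ℝ}, ContDiffOn ℝ 1 R cdisc → ∀ p ∈ Ioo (0 : ℝ) 1 ×ˢ Ioo (-π) π,
      HasFDerivAt R (fderivWithin ℝ R cdisc (polarPt p)) (polarPt p) := fun {R} hR p hp =>
    ((hR.differentiableOn one_ne_zero _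
      (odisc_subset_cdisc (hin p hp))).hasFDerivWithinAt).hasFDerivAt (cdisc_mem_nhds (hin p hp))
  have hpd : Differentiable ℝ polarPt := by
    unfold polarPt
    simp only [Complex.ofReal_cos, Complex.ofReal_sin]
    fun_prop
  have hFd : ∀ p ∈ Ioo (0 : ℝ) 1 ×ˢ Ioo (-π) π, DifferentiableAt ℝ F p := by
    intro p hp
    have h1 : DifferentiableAt ℝ (fun p => P (polarPt p)) p :=
      (hfd hP p hp).differentiableAt.comp p (hpd p)
    have h2 : DifferentiableAt ℝ (fun p => Q (polarPt p)) p :=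
      (hfd hQ p hp).differentiableAt.comp p (hpd p)
    exact differentiableAt_fst.mul ((differentiableAt_snd.cos.mul h1).add
      (differentiableAt_snd.sin.mul h2))
  have hGd : ∀ p ∈ Ioo (0 : ℝ) 1 ×ˢ Ioo (-π) π, DifferentiableAt ℝ G p := by
    intro p hp
    have h1 : DifferentiableAt ℝ (fun p => P (polarPt p)) p :=
      (hfd hP p hp).differentiableAt.comp p (hpd p)
    have h2 : DifferentiableAt ℝ (fun p => Q (polarPt p)) p :=
      (hfd hQ p hp).differentiableAt.comp p (hpd p)
    exact (differentiableAt_snd.sin.mul h1).neg.add (differentiableAt_snd.cos.mul h2)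
  have hdr : ∀ p : ℝ × ℝ, HasDerivAt (fun r => polarPt (r, p.2))
      (Real.cos p.2 + Real.sin p.2 * Complex.I) p.1 := by
    intro p
    have := (Complex.ofRealCLM.hasDerivAt (x := p.1)).mul_const
      ((Real.cos p.2 : ℂ) + Real.sin p.2 * Complex.I)
    simpa [polarPt] using this
  have hdt : ∀ p : ℝ × ℝ, HasDerivAt (fun θ => polarPt (p.1, θ))
      (p.1 * (-Real.sin p.2 + Real.cos p.2 * Complex.I)) p.2 := by
    intro p
    have := ((Real.hasDerivAt_cos p.2).ofReal_comp.add
      ((Real.hasDerivAt_sin p.2).ofReal_comp.mul_const Complex.I)).const_mul (p.1 : ℂ)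
    simpa [polarPt] using this
  have hsum : ∀ p ∈ Ioo (0 : ℝ) 1 ×ˢ Ioo (-π) π,
      fderiv ℝ F p (1, 0) + fderiv ℝ G p (0, 1) = p.1 * dv (polarPt p) := by
    intro p hp
    have e1 : HasDerivAt (fun r => F (r, p.2)) (fderiv ℝ F p (1, 0)) p.1 := by
      have := (hFd p hp).hasFDerivAt.comp_hasDerivAt p.1
        ((hasDerivAt_id p.1).prodMk (hasDerivAt_const p.1 p.2))
      exact this
    have e2 : HasDerivAt (fun θ => G (p.1, θ)) (fderiv ℝ G p (0, 1)) p.2 := by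
      have := (hGd p hp).hasFDerivAt.comp_hasDerivAt p.2
        ((hasDerivAt_const p.2 p.1).prodMk (hasDerivAt_id p.2))
      exact this
    have pr : ∀ {R : ℂ → ℝ}, ContDiffOn ℝ 1 R cdisc → HasDerivAt (fun r => R (polarPt (r, p.2)))
        (fderivWithin ℝ R cdisc (polarPt p) (Real.cos p.2 + Real.sin p.2 * Complex.I)) p.1 :=
      fun {R} hR => (hfd hR p hp).comp_hasDerivAt p.1 (hdr p)
    have pt : ∀ {R : ℂ → ℝ}, ContDiffOn ℝ 1 R cdisc → HasDerivAt (fun θ => R (polarPt (p.1, θ)))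
        (fderivWithin ℝ R cdisc (polarPt p)
          (p.1 * (-Real.sin p.2 + Real.cos p.2 * Complex.I))) p.2 :=
      fun {R} hR => (hfd hR p hp).comp_hasDerivAt p.2 (hdt p)
    have e1' : HasDerivAt (fun r => F (r, p.2)) _ p.1 := (hasDerivAt_id p.1).mul
      (((pr hP).const_mul (Real.cos p.2)).add ((pr hQ).const_mul (Real.sin p.2)))
    have e2' : HasDerivAt (fun θ => G (p.1, θ)) _ p.2 :=
      (((Real.hasDerivAt_sin p.2).mul (pt hP)).neg).add ((Real.hasDerivAt_cos p.2).mul (pt hQ))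
    rw [e1.unique e1', e2.unique e2', apply_eq_re_im (fderivWithin ℝ P cdisc (polarPt p)),
      apply_eq_re_im (fderivWithin ℝ Q cdisc (polarPt p)),
      apply_eq_re_im (fderivWithin ℝ P cdisc (polarPt p)) (_ * _),
      apply_eq_re_im (fderivWithin ℝ Q cdisc (polarPt p)) (_ * _)]
    simp only [hdv, Complex.add_re, Complex.mul_re, Complex.ofReal_re, Complex.ofReal_im,
      Complex.I_re, Complex.I_im, Complex.add_im, Complex.mul_im, Complex.neg_re, Complex.neg_im,
      id]
    have := Real.sin_sq_add_cos_sq p.2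
    linear_combination (p.1 * (fderivWithin ℝ P cdisc (polarPt p) 1 +
      fderivWithin ℝ Q cdisc (polarPt p) Complex.I)) * this
  have hio : (Ioo (0 : ℝ) 1 ×ˢ Ioo (-π) π : Set (ℝ × ℝ)) =ᵐ[volume] Icc ((0 : ℝ), -π) (1, π) := by
    rw [← Icc_prod_Icc]
    exact Measure.set_prod_ae_eq Ioo_ae_eq_Icc Ioo_ae_eq_Icc
  have hmeas : MeasurableSet (Ioo (0 : ℝ) 1 ×ˢ Ioo (-π) π : Set (ℝ × ℝ)) :=
    measurableSet_Ioo.prod measurableSet_Ioo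
  have hint : IntegrableOn (fun p => fderiv ℝ F p (1, 0) + fderiv ℝ G p (0, 1))
      (Icc ((0 : ℝ), -π) (1, π)) := by
    rw [← integrableOn_congr_set_ae hio, integrableOn_congr_fun hsum hmeas,
      integrableOn_congr_set_ae hio]
    exact ((continuous_fst.continuousOn).mul
      (hdvc.comp continuous_polarPt.continuousOn hmaps)).integrableOn_compact isCompact_Icc
  have hπ := Real.pi_pos
  have main := integral_divergence_prod_Icc_of_hasFDerivAt_off_countable_of_le F G
    (fderiv ℝ F) (fderiv ℝ G) ((0 : ℝ), -π) (1, π) ⟨zero_le_one, by simp; linarith⟩ ∅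
    countable_empty
    (continuousOn_fst.mul ((hcos.mul hPc).add (hsin.mul hQc)))
    ((hsin.mul hPc).neg.add (hcos.mul hQc))
    (fun p hp => (hFd p hp.1).hasFDerivAt) (fun p hp => (hGd p hp.1).hasFDerivAt) hint
  rw [ballInt_eq_polar, ← setIntegral_congr_set hio, ← setIntegral_congr_fun hmeas hsum,
    setIntegral_congr_set hio, main, circInt_eq]
  have hGe : ∀ r : ℝ, G (r, π) = G (r, -π) := by intro r; simp [hG, polarPt]
  have hF0 : ∀ θ : ℝ, F (0, θ) = 0 := by intro θ; simp [hF]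
  have hF1 : ∀ θ : ℝ, F (1, θ) = (bpt θ).re * P (bpt θ) + (bpt θ).im * Q (bpt θ) := by
    intro θ
    simp [hF, bpt_eq_polarPt, polarPt, Complex.cos_ofReal_re, Complex.sin_ofReal_re,
      Complex.cos_ofReal_im, Complex.sin_ofReal_im]
  simp only [hGe, hF0, hF1]
  simp

lemma integral_lapW {w : ℂ → ℝ} (hw : ContDiffOn ℝ (⊤ : ℕ∞) w cdisc) :
    ballInt (lapW w) = circInt (nder w) := by
  have h : ∀ e : ℂ, ContDiffOn ℝ 1 (fun x => fderivWithin ℝ w cdisc x e) cdisc := fun e =>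
    ((hw.fderivWithin (m := (⊤ : ℕ∞)) uniqueDiffOn_cdisc (by simp)).clm_apply
      contDiffOn_const).of_le (WithTop.coe_le_coe.2 (le_top (a := (1 : ℕ∞))))
  have := integral_divergence_disc (h 1) (h Complex.I)
  simp_rw [← apply_eq_re_im] at this
  exact this

end Divergence

/-- The functional `I` is integration over the compact set `A ⊆ closure B` against a nonzero
finite measure. -/
def IsDiscIntegral (A : Set ℂ) (I : (ℂ → ℝ) → ℝ) : Prop :=
  IsCompact A ∧ A ⊆ cdisc ∧
    ∃ (X : Type) (_ : MeasurableSpace X) (μ : Measure X) (γ : X → ℂ), IsFiniteMeasure μ ∧ μ ≠ 0 ∧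
      Measurable γ ∧ (∀ᵐ x ∂μ, γ x ∈ A) ∧ ∀ φ, I φ = ∫ x, φ (γ x) ∂μ

lemma isDiscIntegral_ballInt : IsDiscIntegral cdisc ballInt := by
  refine ⟨isCompact_cdisc, subset_rfl, ℂ, inferInstance, volume.restrict odisc, id, ?_, ?_,
    measurable_id, ?_, fun φ => rfl⟩
  · exact ⟨by simp [odisc]⟩
  · intro h
    have : volume odisc = 0 := by rw [← Measure.restrict_apply_univ, h]; simp
    exact (measure_ball_pos volume (0 : ℂ) one_pos).ne' this
  · filter_upwards [ae_restrict_mem measurableSet_ball] with z hz using odisc_subset_cdisc hz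

lemma isDiscIntegral_circInt : IsDiscIntegral bdry circInt := by
  refine ⟨isCompact_bdry, bdry_subset_cdisc, ℝ, inferInstance, volume.restrict (Ioc 0 (2 * π)),
    bpt, inferInstance, ?_, ?_, ?_, ?_⟩
  · intro h
    have : volume (Ioc 0 (2 * π)) = 0 := by rw [← Measure.restrict_apply_univ, h]; simp
    simp [Real.pi_pos.not_ge] at this
  · exact (by unfold bpt; fun_prop : Continuous bpt).measurable
  · exact Eventually.of_forall fun θ => by simp [bdry, bpt, Complex.norm_exp_ofReal_mul_I]
  · intro φ
    rw [circInt, intervalIntegral.integral_of_le (by positivity)]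

namespace IsDiscIntegral

variable {A : Set ℂ} {I : (ℂ → ℝ) → ℝ}

lemma congr (hI : IsDiscIntegral A I) {φ ψ : ℂ → ℝ} (h : EqOn φ ψ A) : I φ = I ψ := by
  obtain ⟨-, -, X, _, μ, γ, _, -, -, hA, hr⟩ := hI
  rw [hr, hr]
  exact integral_congr_ae (hA.mono fun x hx => h hx)

lemma mono (hI : IsDiscIntegral A I) {φ ψ : ℂ → ℝ} (hφ : ContinuousOn φ A)
    (hψ : ContinuousOn ψ A) (h : ∀ z ∈ A, φ z ≤ ψ z) : I φ ≤ I ψ := by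
  obtain ⟨hc, -, X, _, μ, γ, _, -, hm, hA, hr⟩ := hI
  rw [hr, hr]
  exact integral_mono_ae (integrable_comp_of_continuousOn hm hc hA hφ)
    (integrable_comp_of_continuousOn hm hc hA hψ) (hA.mono fun x hx => h _ hx)

lemma add (hI : IsDiscIntegral A I) {φ ψ : ℂ → ℝ} (hφ : ContinuousOn φ A)
    (hψ : ContinuousOn ψ A) : I (fun z => φ z + ψ z) = I φ + I ψ := by
  obtain ⟨hc, -, X, _, μ, γ, _, -, hm, hA, hr⟩ := hI
  rw [hr, hr, hr]
  exact integral_add (integrable_comp_of_continuousOn hm hc hA hφ)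
    (integrable_comp_of_continuousOn hm hc hA hψ)

lemma const_mul (hI : IsDiscIntegral A I) (c : ℝ) (φ : ℂ → ℝ) :
    I (fun z => c * φ z) = c * I φ := by
  obtain ⟨hc, -, X, _, μ, γ, _, -, hm, hA, hr⟩ := hI
  rw [hr, hr]
  exact integral_const_mul c _

lemma pos (hI : IsDiscIntegral A I) {φ : ℂ → ℝ} (hφ : ContinuousOn φ A)
    (h : ∀ z ∈ A, 0 < φ z) : 0 < I φ := by
  obtain ⟨hc, -, X, _, μ, γ, _, h0, hm, hA, hr⟩ := hI
  rw [hr]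
  exact integral_comp_pos hm hc hA h0 hφ h

lemma hasDerivAt (hI : IsDiscIntegral A I) {T : ℝ≥0∞} (hT : 0 < T) {h : ℂ → ℝ}
    (hh : ContinuousOn h A) {G : ℂ × ℝ → ℝ} (hG : ContDiffOn ℝ (⊤ : ℕ∞) G (spaceTime T)) {t : ℝ}
    (ht : t ∈ flowDom T) (h0 : 0 < t) :
    HasDerivAt (fun s => I fun z => h z * G (z, s)) (I fun z => h z * dirD T (0, 1) G (z, t)) t := by
  obtain ⟨hc, hAc, X, _, μ, γ, _, -, hm, hA, hr⟩ := hI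
  simp_rw [hr]
  exact hasDerivAt_integral_slice hT hm hc hAc hA hh hG ht h0

lemma continuousOn (hI : IsDiscIntegral A I) {T : ℝ≥0∞} {h : ℂ → ℝ}
    (hh : ContinuousOn h A) {G : ℂ × ℝ → ℝ} (hG : ContinuousOn G (spaceTime T)) :
    ContinuousOn (fun s => I fun z => h z * G (z, s)) (flowDom T) := by
  obtain ⟨hc, hAc, X, _, μ, γ, _, -, hm, hA, hr⟩ := hI
  simp_rw [hr]
  exact fun t ht => continuousWithinAt_integral_slice hm hc hAc hA hh hG ht

lemma continuousOn_slice (hI : IsDiscIntegral A I) {T : ℝ≥0∞} {G : ℂ × ℝ → ℝ}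
    (hG : ContinuousOn G (spaceTime T)) {t : ℝ} (ht : t ∈ flowDom T) :
    ContinuousOn (fun z => G (z, t)) A :=
  hG.comp (by fun_prop) fun _ hz => mk_mem_prod (hI.2.1 hz) ht

lemma weighted_pos (hI : IsDiscIntegral A I) {T : ℝ≥0∞} {h : ℂ → ℝ}
    (hh : ContinuousOn h A) (hpos : ∀ z ∈ A, 0 < h z) {G : ℂ × ℝ → ℝ}
    (hG : ContinuousOn G (spaceTime T)) (hGpos : ∀ p, 0 < G p) {t : ℝ} (ht : t ∈ flowDom T) :
    0 < I fun z => h z * G (z, t) :=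
  hI.pos (hh.mul (hI.continuousOn_slice hG ht)) fun z hz => mul_pos (hpos z hz) (hGpos _)

/-- Continuity of a normalized coefficient `2 r / ∫ h G`. -/
lemma continuousOn_coeff (hI : IsDiscIntegral A I) {T : ℝ≥0∞} {h : ℂ → ℝ}
    (hh : ContinuousOn h A) (hpos : ∀ z ∈ A, 0 < h z) {G : ℂ × ℝ → ℝ}
    (hG : ContinuousOn G (spaceTime T)) (hGpos : ∀ p, 0 < G p) {r : ℝ → ℝ}
    (hr : ContinuousOn r (flowDom T)) :
    ContinuousOn (fun s => 2 * r s / I fun z => h z * G (z, s)) (flowDom T) :=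
  (hr.const_mul 2).div (hI.continuousOn hh hG)
    fun _ hs => (hI.weighted_pos hh hpos hG hGpos hs).ne'

/-- Derivative of a normalized coefficient `2 r / ∫ h G`. -/
lemma hasDerivAt_coeff (hI : IsDiscIntegral A I) {T : ℝ≥0∞} (hT : 0 < T) {h : ℂ → ℝ}
    (hh : ContinuousOn h A) (hpos : ∀ z ∈ A, 0 < h z) {G : ℂ × ℝ → ℝ}
    (hG : ContDiffOn ℝ (⊤ : ℕ∞) G (spaceTime T)) (hGpos : ∀ p, 0 < G p) {r : ℝ → ℝ} {r' c t : ℝ}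
    (ht : t ∈ flowDom T) (h0 : 0 < t) (hr : HasDerivAt r r' t) (hr0 : r t ≠ 0)
    (hc : c = 2 * r t / I fun z => h z * G (z, t)) :
    HasDerivAt (fun s => 2 * r s / I fun z => h z * G (z, s))
      (c * r' / r t - c ^ 2 / (2 * r t) * I fun z => h z * dirD T (0, 1) G (z, t)) t := by
  have hp := (hI.weighted_pos hh hpos hG.continuousOn hGpos ht).ne'
  refine ((hr.const_mul 2).div (hI.hasDerivAt hT hh hG ht h0) hp).congr_deriv ?_
  rw [hc]
  field_simp

/-- If `φ ≤ M` on `A` and `0 ≤ h ≤ H`, then `-∫ h φ W ≤ H (M ∫ W - ∫ φ W)`. -/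
lemma neg_weighted_le (hI : IsDiscIntegral A I) {h φ W : ℂ → ℝ} {H M : ℝ}
    (hh : ContinuousOn h A) (hφ : ContinuousOn φ A) (hW : ContinuousOn W A)
    (hh0 : ∀ z ∈ A, 0 ≤ h z) (hhH : ∀ z ∈ A, h z ≤ H) (hW0 : ∀ z ∈ A, 0 ≤ W z)
    (hM : 0 ≤ M) (hφM : ∀ z ∈ A, φ z ≤ M) :
    -I (fun z => h z * (φ z * W z)) ≤ H * (M * I W - I fun z => φ z * W z) := by
  have h1 : I (fun z => (-1) * (h z * (φ z * W z))) ≤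
      I fun z => H * (M * W z + (-1) * (φ z * W z)) := by
    refine hI.mono (continuousOn_const.mul (hh.mul (hφ.mul hW))) (continuousOn_const.mul
      ((continuousOn_const.mul hW).add (continuousOn_const.mul (hφ.mul hW)))) fun z hz => ?_
    have a := mul_nonneg (mul_nonneg (sub_nonneg.2 (hhH z hz)) (sub_nonneg.2 (hφM z hz))) (hW0 z hz)
    have b := mul_nonneg (mul_nonneg (hh0 z hz) hM) (hW0 z hz)
    nlinarith
  rw [hI.const_mul, hI.const_mul, hI.add (φ := fun z => M * W z)
    (ψ := fun z => (-1) * (φ z * W z)) (continuousOn_const.mul hW)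
    (continuousOn_const.mul (hφ.mul hW)), hI.const_mul, hI.const_mul] at h1
  linarith

end IsDiscIntegral

lemma deriv_deriv_nonpos_of_isLocalMax {g : ℝ → ℝ} {x : ℝ} (hg : IsLocalMax g x)
    (hc : ContinuousAt g x) : deriv (deriv g) x ≤ 0 := by
  by_contra! h
  have hmin := isLocalMin_of_deriv_deriv_pos h hg.deriv_eq_zero hc
  have hev : g =ᶠ[𝓝 x] fun _ => g x := by
    filter_upwards [hg, hmin] with y h1 h2 using le_antisymm h1 h2
  have : deriv (deriv g) x = 0 := by rw [hev.deriv.deriv_eq]; simp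
  exact h.ne' this

lemma dirD_dirD_nonpos_of_isMaxOn {T : ℝ≥0∞} (hT : 0 < T) {F : ℂ × ℝ → ℝ}
    (hF : ContDiffOn ℝ (⊤ : ℕ∞) F (spaceTime T)) {z : ℂ} {t : ℝ} (hz : z ∈ odisc)
    (ht : t ∈ flowDom T) (hmax : ∀ w ∈ cdisc, F (w, t) ≤ F (z, t)) (e : ℂ) :
    dirD T (e, 0) (dirD T (e, 0) F) (z, t) ≤ 0 := by
  have hline : ∀ s : ℝ, HasDerivAt (fun s : ℝ => z + s • e) e s := fun s => by
    simpa using ((hasDerivAt_id s).smul_const e).const_add z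
  have hev : ∀ᶠ s : ℝ in 𝓝 0, z + s • e ∈ odisc :=
    (hline 0).continuousAt.eventually_mem (isOpen_ball.mem_nhds (by simpa [odisc] using hz))
  have hder : ∀ {G : ℂ × ℝ → ℝ}, ContDiffOn ℝ (⊤ : ℕ∞) G (spaceTime T) → ∀ s : ℝ,
      z + s • e ∈ odisc → HasDerivAt (fun s : ℝ => G (z + s • e, t))
        (dirD T (e, 0) G (z + s • e, t)) s := by
    intro G hG s hs
    have h := (hasFDerivWithinAt_slice hG (odisc_subset_cdisc hs) ht).hasFDerivAt
      (cdisc_mem_nhds hs)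
    have h' := HasFDerivAt.comp_hasDerivAt s h (hline s)
    exact h'
  have h0 : z + (0 : ℝ) • e ∈ odisc := by simpa using hz
  have h1 : deriv (fun s : ℝ => F (z + s • e, t)) =ᶠ[𝓝 0]
      fun s => dirD T (e, 0) F (z + s • e, t) := by
    filter_upwards [hev] with s hs using (hder hF s hs).deriv
  have h2 := deriv_deriv_nonpos_of_isLocalMax (g := fun s : ℝ => F (z + s • e, t)) (x := 0)
    (by
      filter_upwards [hev] with s hs
      simpa using hmax _ (odisc_subset_cdisc hs))
    (hder hF 0 h0).continuousAt
  rw [h1.deriv_eq, (hder (contDiffOn_dirD hT hF _) 0 h0).deriv] at h2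
  simpa using h2

lemma dirD_normal_nonneg_of_isMaxOn {T : ℝ≥0∞} {F : ℂ × ℝ → ℝ}
    (hF : ContDiffOn ℝ (⊤ : ℕ∞) F (spaceTime T)) {z : ℂ} {t : ℝ} (hz : z ∈ cdisc)
    (ht : t ∈ flowDom T) (hmax : ∀ w ∈ cdisc, F (w, t) ≤ F (z, t)) :
    0 ≤ dirD T (z, 0) F (z, t) := by
  have h : IsLocalMaxOn (fun w => F (w, t)) cdisc z :=
    (show IsMaxOn (fun w => F (w, t)) cdisc z from hmax).localize
  have hseg : segment ℝ z (z + -z) ⊆ cdisc :=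
    convex_cdisc.segment_subset hz (by simp [cdisc])
  have := h.fderivWithin_nonpos (mem_posTangentConeAt_of_segment_subset hseg)
  rw [fderivWithin_slice hF hz ht, dirD, show ((-z, 0) : ℂ × ℝ) = -(z, 0) by simp, map_neg] at this
  exact neg_nonpos.1 this

lemma dirD_time_nonneg_of_isMaxOn {T : ℝ≥0∞} {F : ℂ × ℝ → ℝ}
    (hF : ContDiffOn ℝ (⊤ : ℕ∞) F (spaceTime T)) {z : ℂ} {t : ℝ} (hz : z ∈ cdisc)
    (ht : t ∈ flowDom T) (h0 : 0 < t) (hmax : ∀ s ∈ Icc 0 t, F (z, s) ≤ F (z, t)) :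
    0 ≤ dirD T (0, 1) F (z, t) := by
  have h : IsLocalMaxOn (fun s => F (z, s)) (Icc 0 t) t :=
    (show IsMaxOn (fun s => F (z, s)) (Icc 0 t) t from hmax).localize
  have hseg : segment ℝ t (t + -t) ⊆ Icc 0 t :=
    (convex_Icc 0 t).segment_subset ⟨h0.le, le_rfl⟩ (by simp [h0.le])
  have := h.hasFDerivWithinAt_nonpos (hasDerivAt_slice hF hz ht h0).hasFDerivAt.hasFDerivWithinAt
    (mem_posTangentConeAt_of_segment_subset hseg)
  simp only [ContinuousLinearMap.toSpanSingleton_apply, smul_eq_mul] at this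
  nlinarith

/-- A continuous function which exceeds or attains the level `M` somewhere on the parabolic domain,
but is below it initially, attains `M` for a first time at a positive time. -/
lemma exists_first_touching {T : ℝ≥0∞} {F : ℂ × ℝ → ℝ} (hF : ContinuousOn F (spaceTime T)) {M : ℝ}
    (hinit : ∀ z ∈ cdisc, F (z, 0) < M) {z₁ : ℂ} {t₁ : ℝ} (hz₁ : z₁ ∈ cdisc)
    (ht₁ : t₁ ∈ flowDom T) (hM : M ≤ F (z₁, t₁)) :
    ∃ z ∈ cdisc, ∃ t ∈ flowDom T, 0 < t ∧ F (z, t) = M ∧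
      ∀ w ∈ cdisc, ∀ s ∈ Icc 0 t, F (w, s) ≤ M := by
  have hsub : cdisc ×ˢ Icc 0 t₁ ⊆ spaceTime T :=
    prod_mono subset_rfl fun s hs => mem_flowDom_of_le ht₁ hs.1 hs.2
  have hK : IsCompact (cdisc ×ˢ Icc 0 t₁ ∩ F ⁻¹' Ici M) := by
    have hc := isCompact_cdisc.prod (isCompact_Icc (a := (0 : ℝ)) (b := t₁))
    exact hc.of_isClosed_subset
      ((hF.mono hsub).preimage_isClosed_of_isClosed hc.isClosed isClosed_Ici) inter_subset_left
  obtain ⟨⟨z, t⟩, ⟨⟨hz, htI⟩, hzt⟩, hmin⟩ := hK.exists_isMinOn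
    ⟨(z₁, t₁), mk_mem_prod hz₁ ⟨ht₁.1, le_rfl⟩, hM⟩ continuousOn_snd
  simp only at hz htI
  have hzt : M ≤ F (z, t) := hzt
  have ht : t ∈ flowDom T := mem_flowDom_of_le ht₁ htI.1 htI.2
  have h0 : 0 < t := htI.1.lt_of_ne fun h => by
    rw [← h] at hzt
    exact (hinit z hz).not_ge hzt
  have hlt : ∀ w ∈ cdisc, ∀ s ∈ Ico 0 t, F (w, s) < M := by
    intro w hw s hs
    by_contra! hle
    have : t ≤ s := hmin (show (w, s) ∈ cdisc ×ˢ Icc 0 t₁ ∩ F ⁻¹' Ici M from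
      ⟨mk_mem_prod hw ⟨hs.1, hs.2.le.trans htI.2⟩, hle⟩)
    exact this.not_gt hs.2
  have hle : ∀ w ∈ cdisc, ∀ s ∈ Icc 0 t, F (w, s) ≤ M := by
    intro w hw
    have hcont : ContinuousOn (fun s => F (w, s)) (closure (Ico 0 t)) := by
      rw [closure_Ico h0.ne]
      exact hF.comp (by fun_prop) fun s hs =>
        mk_mem_prod hw (mem_flowDom_of_le ht hs.1 hs.2)
    intro s hs
    rw [← closure_Ico h0.ne] at hs
    exact le_on_closure (fun s hs => (hlt w hw s hs).le) hcont continuousOn_const hs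
  exact ⟨z, hz, t, ht, h0, le_antisymm (hle z hz t ⟨h0.le, le_rfl⟩) hzt, hle⟩

lemma dirD_congr {T : ℝ≥0∞} {F G : ℂ × ℝ → ℝ} (h : EqOn F G (spaceTime T)) (e : ℂ × ℝ) :
    EqOn (dirD T e F) (dirD T e G) (spaceTime T) := fun p hp => by
  rw [dirD, dirD, fderivWithin_congr h (h hp)]

lemma dirD_exp {T : ℝ≥0∞} {F : ℂ × ℝ → ℝ} (hF : ContDiffOn ℝ (⊤ : ℕ∞) F (spaceTime T)) (c : ℝ)
    {z : ℂ} {t : ℝ} (hz : z ∈ cdisc) (ht : t ∈ flowDom T) (h0 : 0 < t) :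
    dirD T (0, 1) (fun p => Real.exp (c * F p)) (z, t) =
      c * (dirD T (0, 1) F (z, t) * Real.exp (c * F (z, t))) := by
  have h1 := hasDerivAt_slice (F := fun p => Real.exp (c * F p)) (contDiffOn_const.mul hF).exp
    hz ht h0
  rw [h1.unique ((hasDerivAt_slice hF hz ht h0).const_mul c).exp]
  ring

lemma flowDom_subset_closure (T : ℝ≥0∞) : flowDom T ⊆ closure (flowDom T ∩ Ioi 0) := by
  intro t ht
  obtain ⟨b, hb, htb⟩ := exists_gt_mem_flowDom ht
  have h : Ioo t b ⊆ flowDom T ∩ Ioi 0 := fun s hs =>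
    ⟨mem_flowDom_of_le hb (ht.1.trans hs.1.le) hs.2.le, ht.1.trans_lt hs.1⟩
  refine closure_mono h ?_
  rw [closure_Ioo htb.ne]
  exact ⟨le_rfl, htb.le⟩

/-- A function of position and time as a function on `ℂ × ℝ`. -/
def uncur (u : ℂ → ℝ → ℝ) : ℂ × ℝ → ℝ := fun p => u p.1 p.2

/-- The spatial Laplacian of a function on the parabolic domain. -/
def lapD (T : ℝ≥0∞) (F : ℂ × ℝ → ℝ) (p : ℂ × ℝ) : ℝ :=
  dirD T (1, 0) (dirD T (1, 0) F) p + dirD T (Complex.I, 0) (dirD T (Complex.I, 0) F) p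

lemma contDiffOn_lapD {T : ℝ≥0∞} (hT : 0 < T) {F : ℂ × ℝ → ℝ}
    (hF : ContDiffOn ℝ (⊤ : ℕ∞) F (spaceTime T)) :
    ContDiffOn ℝ (⊤ : ℕ∞) (lapD T F) (spaceTime T) :=
  (contDiffOn_dirD hT (contDiffOn_dirD hT hF _) _).add
    (contDiffOn_dirD hT (contDiffOn_dirD hT hF _) _)

lemma dirD_time_dirD_dirD {T : ℝ≥0∞} (hT : 0 < T) {F : ℂ × ℝ → ℝ}
    (hF : ContDiffOn ℝ (⊤ : ℕ∞) F (spaceTime T)) (e e' : ℂ × ℝ) {p : ℂ × ℝ}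
    (hp : p ∈ spaceTime T) :
    dirD T e' (dirD T e (dirD T e F)) p = dirD T e (dirD T e (dirD T e' F)) p := by
  rw [dirD_comm hT (contDiffOn_dirD hT hF e) e' e hp]
  exact dirD_congr (fun q hq => dirD_comm hT hF e' e hq) e hp

lemma hasDerivAt_lapD {T : ℝ≥0∞} (hT : 0 < T) {F : ℂ × ℝ → ℝ}
    (hF : ContDiffOn ℝ (⊤ : ℕ∞) F (spaceTime T)) {z : ℂ} {t : ℝ} (hz : z ∈ cdisc)
    (ht : t ∈ flowDom T) (h0 : 0 < t) :
    HasDerivAt (fun s => lapD T F (z, s)) (lapD T (dirD T (0, 1) F) (z, t)) t := by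
  have h : ∀ e : ℂ × ℝ, HasDerivAt (fun s => dirD T e (dirD T e F) (z, s))
      (dirD T e (dirD T e (dirD T (0, 1) F)) (z, t)) t := fun e => by
    rw [← dirD_time_dirD_dirD hT hF e (0, 1) (mk_mem_prod hz ht)]
    exact hasDerivAt_slice (contDiffOn_dirD hT (contDiffOn_dirD hT hF e) e) hz ht h0
  exact (h _).add (h _)

section Flow

variable {f j : ℂ → ℝ} {T : ℝ≥0∞} {u : ℂ → ℝ → ℝ} {ρ : ℝ → ℝ}

lemma IsFlow.smooth (hflow : IsFlow f j T u ρ) :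
    ContDiffOn ℝ (⊤ : ℕ∞) (uncur u) (spaceTime T) := hflow.1

lemma Kcur_eq (hT : 0 < T) (hflow : IsFlow f j T u ρ) {t : ℝ} {z : ℂ} (ht : t ∈ flowDom T)
    (hz : z ∈ cdisc) : Kcur u t z = Real.exp (-(2 * u z t)) * -lapD T (uncur u) (z, t) := by
  rw [Kcur, lapD, ← lapW_slice hT hflow.smooth hz ht]
  rfl

lemma nder_eq (hflow : IsFlow f j T u ρ) {t : ℝ} {z : ℂ} (ht : t ∈ flowDom T)
    (hz : z ∈ cdisc) : nder (fun w => u w t) z = dirD T (z, 0) (uncur u) (z, t) :=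
  fderivWithin_slice hflow.smooth hz ht z

lemma betaC_eq (j : ℂ → ℝ) (u : ℂ → ℝ → ℝ) (ρ : ℝ → ℝ) (t : ℝ) :
    betaC j u ρ t = 2 * (π - ρ t) / circInt fun z => j z * Real.exp (1 * uncur u (z, t)) := by
  simp [betaC, uncur]

lemma contDiffOn_exp_uncur (hflow : IsFlow f j T u ρ) (c : ℝ) :
    ContDiffOn ℝ (⊤ : ℕ∞) (fun p => Real.exp (c * uncur u p)) (spaceTime T) :=
  (contDiffOn_const.mul hflow.smooth).exp

lemma continuousOn_alphaC (hf : ContinuousOn f cdisc) (hfpos : ∀ z ∈ cdisc, 0 < f z)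
    (hflow : IsFlow f j T u ρ) : ContinuousOn (alphaC f u ρ) (flowDom T) :=
  isDiscIntegral_ballInt.continuousOn_coeff hf hfpos (contDiffOn_exp_uncur hflow 2).continuousOn
    (fun _ => Real.exp_pos _) hflow.2.1.continuousOn

lemma continuousOn_betaC (hj : ContinuousOn j bdry) (hjpos : ∀ z ∈ bdry, 0 < j z)
    (hflow : IsFlow f j T u ρ) : ContinuousOn (betaC j u ρ) (flowDom T) := by
  rw [show betaC j u ρ = _ from funext (betaC_eq j u ρ)]
  exact isDiscIntegral_circInt.continuousOn_coeff hj hjpos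
    (contDiffOn_exp_uncur hflow 1).continuousOn (fun _ => Real.exp_pos _)
    (r := fun s => π - ρ s) (continuousOn_const.sub hflow.2.1.continuousOn)

lemma continuousOn_time_slice {F : ℂ × ℝ → ℝ} (hF : ContinuousOn F (spaceTime T)) {z : ℂ}
    (hz : z ∈ cdisc) : ContinuousOn (fun s => F (z, s)) (flowDom T) :=
  hF.comp (by fun_prop) fun _ hs => mk_mem_prod hz hs

lemma deriv_eq_dirD (hflow : IsFlow f j T u ρ) {t : ℝ} {z : ℂ} (ht : t ∈ flowDom T) (h0 : 0 < t)
    (hz : z ∈ cdisc) : deriv (u z) t = dirD T (0, 1) (uncur u) (z, t) :=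
  (hasDerivAt_slice hflow.smooth hz ht h0).deriv

/-- The interior evolution equation holds up to the boundary and the initial time. -/
lemma flow_interior (hT : 0 < T) (hf : ContinuousOn f cdisc) (hfpos : ∀ z ∈ cdisc, 0 < f z)
    (hflow : IsFlow f j T u ρ) {t : ℝ} {z : ℂ} (ht : t ∈ flowDom T) (hz : z ∈ cdisc) :
    dirD T (0, 1) (uncur u) (z, t) =
      alphaC f u ρ t * f z + Real.exp (-(2 * uncur u (z, t))) * lapD T (uncur u) (z, t) := by
  have hU := hflow.smooth
  have hc₁ := (contDiffOn_dirD hT hU (0, 1)).continuousOn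
  have hc₂ : ContinuousOn (fun p => Real.exp (-(2 * uncur u p)) * lapD T (uncur u) p)
      (spaceTime T) :=
    (continuousOn_const.mul hU.continuousOn).neg.rexp.mul (contDiffOn_lapD hT hU).continuousOn
  have step₁ : ∀ s ∈ flowDom T ∩ Ioi 0, ∀ w ∈ cdisc, dirD T (0, 1) (uncur u) (w, s) =
      alphaC f u ρ s * f w + Real.exp (-(2 * uncur u (w, s))) * lapD T (uncur u) (w, s) := by
    rintro s ⟨hs, hs0⟩
    refine EqOn.of_subset_closure (s := odisc) (fun w hw => ?_)
      (isDiscIntegral_ballInt.continuousOn_slice hc₁ hs)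
      ((continuousOn_const.mul hf).add (isDiscIntegral_ballInt.continuousOn_slice hc₂ hs))
      odisc_subset_cdisc closure_odisc.ge
    have hw' := odisc_subset_cdisc hw
    rw [← deriv_eq_dirD hflow hs hs0 hw', hflow.2.2.2.1 s hs hs0 w hw, lapD,
      ← lapW_slice hT hU hw' hs]
    rfl
  exact EqOn.of_subset_closure (s := flowDom T ∩ Ioi 0) (fun s hs => step₁ s hs z hz)
    (continuousOn_time_slice hc₁ hz)
    (((continuousOn_alphaC hf hfpos hflow).mul continuousOn_const).add
      (continuousOn_time_slice hc₂ hz)) inter_subset_left (flowDom_subset_closure T) ht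

/-- The boundary evolution equation holds up to the initial time. -/
lemma flow_boundary (hT : 0 < T) (hj : ContinuousOn j bdry) (hjpos : ∀ z ∈ bdry, 0 < j z)
    (hflow : IsFlow f j T u ρ) {t : ℝ} {z : ℂ} (ht : t ∈ flowDom T) (hz : z ∈ bdry) :
    dirD T (0, 1) (uncur u) (z, t) = betaC j u ρ t * j z -
      Real.exp (-uncur u (z, t)) * (dirD T (z, 0) (uncur u) (z, t) + 1) := by
  have hU := hflow.smooth
  have hz' := bdry_subset_cdisc hz
  have hc₂ : ContinuousOn (fun p => Real.exp (-uncur u p) * (dirD T (z, 0) (uncur u) p + 1))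
      (spaceTime T) :=
    hU.continuousOn.neg.rexp.mul
      ((contDiffOn_dirD hT hU (z, 0)).continuousOn.add continuousOn_const)
  refine EqOn.of_subset_closure (s := flowDom T ∩ Ioi 0) (fun s hs => ?_)
    (continuousOn_time_slice (contDiffOn_dirD hT hU (0, 1)).continuousOn hz')
    (((continuousOn_betaC hj hjpos hflow).mul continuousOn_const).sub
      (continuousOn_time_slice hc₂ hz')) inter_subset_left (flowDom_subset_closure T) ht
  rw [← deriv_eq_dirD hflow hs.1 hs.2 hz', hflow.2.2.2.2.1 s hs.1 hs.2 z hz,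
    nder_eq hflow hs.1 hz']
  rfl

lemma alphaC_mul_ballInt (hf : ContinuousOn f cdisc) (hfpos : ∀ z ∈ cdisc, 0 < f z)
    (hflow : IsFlow f j T u ρ) {t : ℝ} (ht : t ∈ flowDom T) :
    alphaC f u ρ t * (ballInt fun z => f z * Real.exp (2 * uncur u (z, t))) = 2 * ρ t :=
  div_mul_cancel₀ _ (isDiscIntegral_ballInt.weighted_pos hf hfpos
    (contDiffOn_exp_uncur hflow 2).continuousOn (fun _ => Real.exp_pos _) ht).ne'

lemma betaC_mul_circInt (hj : ContinuousOn j bdry) (hjpos : ∀ z ∈ bdry, 0 < j z)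
    (hflow : IsFlow f j T u ρ) {t : ℝ} (ht : t ∈ flowDom T) :
    betaC j u ρ t * (circInt fun z => j z * Real.exp (1 * uncur u (z, t))) = 2 * (π - ρ t) := by
  rw [betaC_eq]
  exact div_mul_cancel₀ _ (isDiscIntegral_circInt.weighted_pos hj hjpos
    (contDiffOn_exp_uncur hflow 1).continuousOn (fun _ => Real.exp_pos _) ht).ne'

lemma alphaC_pos (hf : ContinuousOn f cdisc) (hfpos : ∀ z ∈ cdisc, 0 < f z)
    (hflow : IsFlow f j T u ρ) {t : ℝ} (ht : t ∈ flowDom T) : 0 < alphaC f u ρ t :=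
  div_pos (mul_pos two_pos (hflow.2.2.1 t ht).1) (isDiscIntegral_ballInt.weighted_pos hf hfpos
    (contDiffOn_exp_uncur hflow 2).continuousOn (fun _ => Real.exp_pos _) ht)

lemma betaC_pos (hj : ContinuousOn j bdry) (hjpos : ∀ z ∈ bdry, 0 < j z)
    (hflow : IsFlow f j T u ρ) {t : ℝ} (ht : t ∈ flowDom T) : 0 < betaC j u ρ t := by
  rw [betaC_eq]
  exact div_pos (mul_pos two_pos (sub_pos.2 (hflow.2.2.1 t ht).2))
    (isDiscIntegral_circInt.weighted_pos hj hjpos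
      (contDiffOn_exp_uncur hflow 1).continuousOn (fun _ => Real.exp_pos _) ht)

/-- The first variation of the mass vanishes along the flow. -/
lemma mass_variation (hT : 0 < T) (hf : ContinuousOn f cdisc) (hfpos : ∀ z ∈ cdisc, 0 < f z)
    (hj : ContinuousOn j bdry) (hjpos : ∀ z ∈ bdry, 0 < j z)
    (hflow : IsFlow f j T u ρ) {t : ℝ} (ht : t ∈ flowDom T) :
    (ballInt fun z => dirD T (0, 1) (uncur u) (z, t) * Real.exp (2 * uncur u (z, t))) +
      (circInt fun z => dirD T (0, 1) (uncur u) (z, t) * Real.exp (1 * uncur u (z, t))) = 0 := by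
  have hU := hflow.smooth
  have hB := isDiscIntegral_ballInt
  have hS := isDiscIntegral_circInt
  have hE₂ := hB.continuousOn_slice (contDiffOn_exp_uncur hflow 2).continuousOn ht
  have hE₁ := hS.continuousOn_slice (contDiffOn_exp_uncur hflow 1).continuousOn ht
  have e₁ : (ballInt fun z => dirD T (0, 1) (uncur u) (z, t) * Real.exp (2 * uncur u (z, t))) =
      ballInt fun z => alphaC f u ρ t * (f z * Real.exp (2 * uncur u (z, t))) +
        lapD T (uncur u) (z, t) := by
    refine hB.congr fun z hz => ?_
    rw [flow_interior hT hf hfpos hflow ht hz, Real.exp_neg]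
    field_simp
  have e₂ : (circInt fun z => dirD T (0, 1) (uncur u) (z, t) * Real.exp (1 * uncur u (z, t))) =
      circInt fun z => betaC j u ρ t * (j z * Real.exp (1 * uncur u (z, t))) +
        (-1) * (dirD T (z, 0) (uncur u) (z, t) + 1) := by
    refine hS.congr fun z hz => ?_
    rw [flow_boundary hT hj hjpos hflow ht hz, Real.exp_neg, one_mul]
    field_simp
    ring
  have hn : ContinuousOn (fun z => dirD T (z, 0) (uncur u) (z, t)) bdry := by
    have h : ∀ e : ℂ, ContinuousOn (fun z => dirD T (e, 0) (uncur u) (z, t)) bdry := fun e =>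
      hS.continuousOn_slice (contDiffOn_dirD hT hU (e, 0)).continuousOn ht
    refine ((Complex.continuous_re.continuousOn.mul (h 1)).add
      (Complex.continuous_im.continuousOn.mul (h Complex.I))).congr fun z hz => ?_
    exact apply_eq_re_im ((fderivWithin ℝ (uncur u) (spaceTime T) (z, t)).comp
      (ContinuousLinearMap.inl ℝ ℂ ℝ)) z
  have hlap : ballInt (fun z => lapD T (uncur u) (z, t)) =
      circInt fun z => dirD T (z, 0) (uncur u) (z, t) := by
    rw [hB.congr (φ := fun z => lapD T (uncur u) (z, t))
        (ψ := lapW fun w => uncur u (w, t)) fun z hz => (lapW_slice hT hU hz ht).symm,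
      integral_lapW (w := fun w => uncur u (w, t)) (hU.comp (contDiffOn_id.prodMk contDiffOn_const)
        fun z hz => mk_mem_prod hz ht)]
    exact hS.congr fun z hz => nder_eq hflow ht (bdry_subset_cdisc hz)
  rw [e₁, e₂, hB.add (φ := fun z => alphaC f u ρ t * (f z * Real.exp (2 * uncur u (z, t))))
      (ψ := fun z => lapD T (uncur u) (z, t)) (continuousOn_const.mul (hf.mul hE₂))
      (hB.continuousOn_slice (contDiffOn_lapD hT hU).continuousOn ht),
    hS.add (φ := fun z => betaC j u ρ t * (j z * Real.exp (1 * uncur u (z, t))))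
      (ψ := fun z => (-1) * (dirD T (z, 0) (uncur u) (z, t) + 1))
      (continuousOn_const.mul (hj.mul hE₁))
      (continuousOn_const.mul (hn.add continuousOn_const)),
    hB.const_mul, hS.const_mul, hS.const_mul, alphaC_mul_ballInt hf hfpos hflow ht,
    betaC_mul_circInt hj hjpos hflow ht, hlap,
    hS.add (φ := fun z => dirD T (z, 0) (uncur u) (z, t)) (ψ := fun _ => 1) hn continuousOn_const]
  have : circInt (fun _ => 1) = 2 * π := by simp [circInt]
  rw [this]
  ring

/-- Conservation of the mass `½∫_B e^{2u} + ∫_{∂B} e^u`. -/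
lemma mass_eq (hT : 0 < T) (hf : ContinuousOn f cdisc) (hfpos : ∀ z ∈ cdisc, 0 < f z)
    (hj : ContinuousOn j bdry) (hjpos : ∀ z ∈ bdry, 0 < j z)
    (hflow : IsFlow f j T u ρ) {t : ℝ} (ht : t ∈ flowDom T) :
    (1 / 2) * (ballInt fun z => Real.exp (2 * uncur u (z, t))) +
        (circInt fun z => Real.exp (1 * uncur u (z, t))) =
      (1 / 2) * (ballInt fun z => Real.exp (2 * uncur u (z, 0))) +
        circInt fun z => Real.exp (1 * uncur u (z, 0)) := by
  have hB := isDiscIntegral_ballInt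
  have hS := isDiscIntegral_circInt
  have hd : ∀ {A : Set ℂ} {I : (ℂ → ℝ) → ℝ}, IsDiscIntegral A I → ∀ c : ℝ, ∀ s ∈ flowDom T,
      0 < s → HasDerivAt (fun s => I fun z => Real.exp (c * uncur u (z, s)))
        (c * I fun z => dirD T (0, 1) (uncur u) (z, s) * Real.exp (c * uncur u (z, s))) s := by
    intro A I hI c s hs h0
    have h := hI.hasDerivAt hT (h := fun _ => 1) continuousOn_const (contDiffOn_exp_uncur hflow c)
      hs h0
    simp only [one_mul] at h
    rw [← hI.const_mul]
    exact h.congr_deriv (hI.congr fun z hz => dirD_exp hflow.smooth c (hI.2.1 hz) hs h0)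
  have hc : ∀ {A : Set ℂ} {I : (ℂ → ℝ) → ℝ}, IsDiscIntegral A I → ∀ c : ℝ,
      ContinuousOn (fun s => I fun z => Real.exp (c * uncur u (z, s))) (flowDom T) := by
    intro A I hI c
    simpa only [one_mul] using hI.continuousOn (h := fun _ => 1) continuousOn_const
      (contDiffOn_exp_uncur hflow c).continuousOn
  rcases ht.1.eq_or_lt with rfl | h0
  · rfl
  set m : ℝ → ℝ := fun s => (1 / 2) * (ballInt fun z => Real.exp (2 * uncur u (z, s))) +
        (circInt fun z => Real.exp (1 * uncur u (z, s))) with hm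
  have hsub : Icc 0 t ⊆ flowDom T := fun s hs => mem_flowDom_of_le ht hs.1 hs.2
  obtain ⟨c, hcI, hc'⟩ := exists_hasDerivAt_eq_slope m (fun _ => 0) h0
    (((continuousOn_const.mul (hc hB 2)).add (hc hS 1)).mono hsub) fun s hs => by
      have hs' := hsub ⟨hs.1.le, hs.2.le⟩
      refine (((hd hB 2 s hs' hs.1).const_mul (1 / 2)).add (hd hS 1 s hs' hs.1)).congr_deriv ?_
      linarith [mass_variation hT hf hfpos hj hjpos hflow hs']
  rw [eq_comm, div_eq_zero_iff] at hc'
  rcases hc' with h | h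
  · exact sub_eq_zero.1 h
  · linarith

lemma integral_variation_le {A : Set ℂ} {I : (ℂ → ℝ) → ℝ} (hI : IsDiscIntegral A I) (hT : 0 < T)
    (hflow : IsFlow f j T u ρ) {t M : ℝ} (ht : t ∈ flowDom T)
    (hM : ∀ w ∈ cdisc, dirD T (0, 1) (uncur u) (w, t) ≤ M) (c : ℝ) :
    (I fun z => dirD T (0, 1) (uncur u) (z, t) * Real.exp (c * uncur u (z, t))) ≤
      M * I fun z => Real.exp (c * uncur u (z, t)) := by
  have hE := hI.continuousOn_slice (contDiffOn_exp_uncur hflow c).continuousOn ht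
  have hD := hI.continuousOn_slice (contDiffOn_dirD hT hflow.smooth (0, 1)).continuousOn ht
  rw [← hI.const_mul]
  exact hI.mono (hD.mul hE) (continuousOn_const.mul hE) fun z hz =>
    mul_le_mul_of_nonneg_right (hM z (hI.2.1 hz)) (Real.exp_pos _).le

lemma hasDerivAt_rho (hflow : IsFlow f j T u ρ) {t : ℝ} (ht : t ∈ flowDom T) (h0 : 0 < t) :
    HasDerivAt ρ (deriv ρ t) t :=
  ((hflow.2.1.contDiffAt (flowDom_mem_nhds ht h0)).differentiableAt one_ne_zero).hasDerivAt

lemma integral_mul_dirD_exp {A : Set ℂ} {I : (ℂ → ℝ) → ℝ} (hI : IsDiscIntegral A I)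
    (hflow : IsFlow f j T u ρ) (h : ℂ → ℝ) (c : ℝ) {t : ℝ} (ht : t ∈ flowDom T) (h0 : 0 < t) :
    (I fun z => h z * dirD T (0, 1) (fun p => Real.exp (c * uncur u p)) (z, t)) =
      c * I fun z => h z * (dirD T (0, 1) (uncur u) (z, t) * Real.exp (c * uncur u (z, t))) := by
  rw [← hI.const_mul]
  refine hI.congr fun z hz => ?_
  rw [dirD_exp hflow.smooth c (hI.2.1 hz) ht h0]
  ring

/-- The time derivative of `α f`, as long as `∂u/∂t ≤ M` on the closed disc. -/
lemma exists_hasDerivAt_alphaC (hT : 0 < T) (hf : ContinuousOn f cdisc)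
    (hfpos : ∀ z ∈ cdisc, 0 < f z) (hj : ContinuousOn j bdry) (hjpos : ∀ z ∈ bdry, 0 < j z)
    (hflow : IsFlow f j T u ρ) {m₀ : ℝ}
    (hm₀ : m₀ = (1 / 2) * (ballInt fun z => Real.exp (2 * uncur u (z, 0))) +
      circInt fun z => Real.exp (1 * uncur u (z, 0)))
    {H C M t : ℝ} (ht : t ∈ flowDom T) (h0 : 0 < t) (hH : ∀ z ∈ cdisc, f z ≤ H) (hM0 : 0 ≤ M)
    (hM : ∀ w ∈ cdisc, dirD T (0, 1) (uncur u) (w, t) ≤ M)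
    (hC : alphaC f u ρ t * |deriv ρ t| / ρ t * H ≤ C)
    (hC' : alphaC f u ρ t ^ 2 / ρ t * H ^ 2 ≤ C) :
    ∃ a, HasDerivAt (alphaC f u ρ) a t ∧ ∀ z ∈ cdisc, a * f z ≤ C + 2 * m₀ * C * M := by
  have hB := isDiscIntegral_ballInt
  have hS := isDiscIntegral_circInt
  have hρ := (hflow.2.2.1 t ht).1
  have hα := alphaC_pos hf hfpos hflow ht
  refine ⟨_, hB.hasDerivAt_coeff hT hf hfpos (contDiffOn_exp_uncur hflow 2)
    (fun _ => Real.exp_pos _) ht h0 (hasDerivAt_rho hflow ht h0) hρ.ne' rfl, fun z hz => ?_⟩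
  have hE := hB.continuousOn_slice (contDiffOn_exp_uncur hflow 2).continuousOn ht
  have hD := hB.continuousOn_slice (contDiffOn_dirD hT hflow.smooth (0, 1)).continuousOn ht
  have hw := hB.neg_weighted_le (W := fun z => Real.exp (2 * uncur u (z, t)))
    hf hD hE (fun z hz => (hfpos z hz).le) hH (fun _ _ => (Real.exp_pos _).le) hM0 hM
  have hv := mass_variation hT hf hfpos hj hjpos hflow ht
  have hm := mass_eq hT hf hfpos hj hjpos hflow ht
  have hL := integral_variation_le hS hT hflow ht hM 1
  have hLpos : 0 < circInt fun z => Real.exp (1 * uncur u (z, t)) :=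
    hS.pos (hS.continuousOn_slice (contDiffOn_exp_uncur hflow 1).continuousOn ht)
      fun _ _ => Real.exp_pos _
  rw [← hm₀] at hm
  rw [integral_mul_dirD_exp hB hflow f 2 ht h0]
  have hfz := hfpos z hz
  have hfH := hH z hz
  have hH0 : 0 ≤ H := hfz.le.trans hfH
  change (alphaC f u ρ t * deriv ρ t / ρ t - alphaC f u ρ t ^ 2 / (2 * ρ t) * _) * f z ≤ _
  set a := alphaC f u ρ t
  set W := ballInt fun z => f z * (dirD T (0, 1) (uncur u) (z, t) * Real.exp (2 * uncur u (z, t)))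
  have hW : -W ≤ H * (2 * m₀ * M) :=
    hw.trans (mul_le_mul_of_nonneg_left (by nlinarith [mul_nonneg hM0 hLpos.le]) hH0)
  have hm0 : 0 ≤ 2 * m₀ * M := by
    have : 0 < ballInt fun z => Real.exp (2 * uncur u (z, t)) := hB.pos hE fun _ _ => Real.exp_pos _
    exact mul_nonneg (by linarith) hM0
  have e1 : a * deriv ρ t / ρ t * f z ≤ a * |deriv ρ t| / ρ t * H := by
    have := le_abs_self (deriv ρ t)
    have := abs_nonneg (deriv ρ t)
    gcongr
  have e2 : a ^ 2 / ρ t * (-W) * f z ≤ a ^ 2 / ρ t * (H * (2 * m₀ * M)) * H := by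
    gcongr
  have e3 : (a ^ 2 / ρ t * H ^ 2) * (2 * m₀ * M) ≤ C * (2 * m₀ * M) := by gcongr
  calc (a * deriv ρ t / ρ t - a ^ 2 / (2 * ρ t) * (2 * W)) * f z
      = a * deriv ρ t / ρ t * f z + a ^ 2 / ρ t * (-W) * f z := by field_simp; ring
    _ ≤ C + 2 * m₀ * C * M := by linarith

/-- The time derivative of `β j`, as long as `∂u/∂t ≤ M` on the closed disc. -/
lemma exists_hasDerivAt_betaC (hT : 0 < T) (hf : ContinuousOn f cdisc)
    (hfpos : ∀ z ∈ cdisc, 0 < f z) (hj : ContinuousOn j bdry) (hjpos : ∀ z ∈ bdry, 0 < j z)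
    (hflow : IsFlow f j T u ρ) {m₀ : ℝ}
    (hm₀ : m₀ = (1 / 2) * (ballInt fun z => Real.exp (2 * uncur u (z, 0))) +
      circInt fun z => Real.exp (1 * uncur u (z, 0)))
    {H C M t : ℝ} (ht : t ∈ flowDom T) (h0 : 0 < t) (hH : ∀ z ∈ bdry, j z ≤ H) (hM0 : 0 ≤ M)
    (hM : ∀ w ∈ cdisc, dirD T (0, 1) (uncur u) (w, t) ≤ M)
    (hC : 2 * betaC j u ρ t * |deriv ρ t| / (π - ρ t) * H ≤ C)
    (hC' : betaC j u ρ t ^ 2 / (π - ρ t) * H ^ 2 ≤ C) :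
    ∃ b, HasDerivAt (betaC j u ρ) b t ∧ ∀ z ∈ bdry, 2 * (b * j z) ≤ C + 2 * m₀ * C * M := by
  have hB := isDiscIntegral_ballInt
  have hS := isDiscIntegral_circInt
  have hρ : 0 < π - ρ t := sub_pos.2 (hflow.2.2.1 t ht).2
  have hβ := betaC_pos hj hjpos hflow ht
  have hder := hS.hasDerivAt_coeff hT hj hjpos (contDiffOn_exp_uncur hflow 1)
    (fun _ => Real.exp_pos _) (r := fun s => π - ρ s) ht h0
    ((hasDerivAt_rho hflow ht h0).const_sub π) hρ.ne' (betaC_eq j u ρ t)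
  rw [← show betaC j u ρ = _ from funext (betaC_eq j u ρ)] at hder
  refine ⟨_, hder, fun z hz => ?_⟩
  have hE := hS.continuousOn_slice (contDiffOn_exp_uncur hflow 1).continuousOn ht
  have hD := hS.continuousOn_slice (contDiffOn_dirD hT hflow.smooth (0, 1)).continuousOn ht
  have hw := hS.neg_weighted_le (W := fun z => Real.exp (1 * uncur u (z, t)))
    hj hD hE (fun z hz => (hjpos z hz).le) hH (fun _ _ => (Real.exp_pos _).le) hM0
    fun z hz => hM z (bdry_subset_cdisc hz)
  have hv := mass_variation hT hf hfpos hj hjpos hflow ht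
  have hm := mass_eq hT hf hfpos hj hjpos hflow ht
  have hL := integral_variation_le hB hT hflow ht hM 2
  have hLpos : 0 < circInt fun z => Real.exp (1 * uncur u (z, t)) :=
    hS.pos hE fun _ _ => Real.exp_pos _
  have hApos : 0 < ballInt fun z => Real.exp (2 * uncur u (z, t)) :=
    hB.pos (hB.continuousOn_slice (contDiffOn_exp_uncur hflow 2).continuousOn ht)
      fun _ _ => Real.exp_pos _
  rw [← hm₀] at hm
  rw [integral_mul_dirD_exp hS hflow j 1 ht h0]
  have hjz := hjpos z hz
  have hjH := hH z hz
  have hH0 : 0 ≤ H := hjz.le.trans hjH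
  set b := betaC j u ρ t
  set W := circInt fun z => j z * (dirD T (0, 1) (uncur u) (z, t) * Real.exp (1 * uncur u (z, t)))
  have hW : -W ≤ H * (2 * m₀ * M) :=
    hw.trans (mul_le_mul_of_nonneg_left (by nlinarith [mul_nonneg hM0 hLpos.le]) hH0)
  have hm0 : 0 ≤ 2 * m₀ * M := mul_nonneg (by linarith) hM0
  have e1 : 2 * b * -deriv ρ t / (π - ρ t) * j z ≤ 2 * b * |deriv ρ t| / (π - ρ t) * H := by
    have := neg_le_abs (deriv ρ t)
    have := abs_nonneg (deriv ρ t)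
    gcongr
  have e2 : b ^ 2 / (π - ρ t) * (-W) * j z ≤ b ^ 2 / (π - ρ t) * (H * (2 * m₀ * M)) * H := by
    gcongr
  have e3 : (b ^ 2 / (π - ρ t) * H ^ 2) * (2 * m₀ * M) ≤ C * (2 * m₀ * M) := by gcongr
  calc 2 * ((b * -deriv ρ t / (π - ρ t) - b ^ 2 / (2 * (π - ρ t)) * (1 * W)) * j z)
      = 2 * b * -deriv ρ t / (π - ρ t) * j z + b ^ 2 / (π - ρ t) * (-W) * j z := by
        field_simp; ring
    _ ≤ C + 2 * m₀ * C * M := by linarith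

/-- Differentiated interior equation at an interior spatial maximum of `∂u/∂t`. -/
lemma dirD_time_le_of_interior_max (hT : 0 < T) (hf : ContinuousOn f cdisc)
    (hfpos : ∀ z ∈ cdisc, 0 < f z) (hflow : IsFlow f j T u ρ) {t M a : ℝ} {z : ℂ}
    (ht : t ∈ flowDom T) (h0 : 0 < t) (hz : z ∈ odisc)
    (hM : ∀ w ∈ cdisc, dirD T (0, 1) (uncur u) (w, t) ≤ M)
    (hzM : dirD T (0, 1) (uncur u) (z, t) = M) (ha : HasDerivAt (alphaC f u ρ) a t) :
    dirD T (0, 1) (dirD T (0, 1) (uncur u)) (z, t) ≤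
      a * f z - 2 * M * (M - alphaC f u ρ t * f z) := by
  have hU := hflow.smooth
  have hUt := contDiffOn_dirD hT hU (0, 1)
  have hz' := odisc_subset_cdisc hz
  have hev : (fun s => dirD T (0, 1) (uncur u) (z, s)) =ᶠ[𝓝 t] fun s =>
      alphaC f u ρ s * f z + Real.exp (-(2 * uncur u (z, s))) * lapD T (uncur u) (z, s) := by
    filter_upwards [flowDom_mem_nhds ht h0] with s hs using flow_interior hT hf hfpos hflow hs hz'
  have hd := ((ha.mul_const (f z)).add
    ((((hasDerivAt_slice hU hz' ht h0).const_mul 2).neg.exp).mul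
      (hasDerivAt_lapD hT hU hz' ht h0)))
  have heq := (hasDerivAt_slice hUt hz' ht h0).unique (hd.congr_of_eventuallyEq hev)
  simp only [Pi.neg_apply] at heq
  have hflowz := flow_interior hT hf hfpos hflow ht hz'
  have hlap : lapD T (dirD T (0, 1) (uncur u)) (z, t) ≤ 0 :=
    add_nonpos (dirD_dirD_nonpos_of_isMaxOn hT hUt hz ht (hzM ▸ hM) 1)
      (dirD_dirD_nonpos_of_isMaxOn hT hUt hz ht (hzM ▸ hM) Complex.I)
  rw [hzM] at heq hflowz
  rw [heq]
  have := mul_nonpos_of_nonneg_of_nonpos (Real.exp_pos (-(2 * uncur u (z, t)))).le hlap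
  have e : M - alphaC f u ρ t * f z =
    Real.exp (-(2 * uncur u (z, t))) * lapD T (uncur u) (z, t) := by linarith
  rw [e]
  linarith

/-- Differentiated boundary equation at a spatial maximum of `∂u/∂t` on the boundary. -/
lemma dirD_time_le_of_boundary_max (hT : 0 < T) (hj : ContinuousOn j bdry)
    (hjpos : ∀ z ∈ bdry, 0 < j z) (hflow : IsFlow f j T u ρ) {t M b : ℝ} {z : ℂ}
    (ht : t ∈ flowDom T) (h0 : 0 < t) (hz : z ∈ bdry)
    (hM : ∀ w ∈ cdisc, dirD T (0, 1) (uncur u) (w, t) ≤ M)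
    (hzM : dirD T (0, 1) (uncur u) (z, t) = M) (hb : HasDerivAt (betaC j u ρ) b t) :
    dirD T (0, 1) (dirD T (0, 1) (uncur u)) (z, t) ≤
      b * j z - M * (M - betaC j u ρ t * j z) := by
  have hU := hflow.smooth
  have hUt := contDiffOn_dirD hT hU (0, 1)
  have hz' := bdry_subset_cdisc hz
  have hev : (fun s => dirD T (0, 1) (uncur u) (z, s)) =ᶠ[𝓝 t] fun s =>
      betaC j u ρ s * j z -
        Real.exp (-uncur u (z, s)) * (dirD T (z, 0) (uncur u) (z, s) + 1) := by
    filter_upwards [flowDom_mem_nhds ht h0] with s hs using flow_boundary hT hj hjpos hflow hs hz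
  have hd := ((hb.mul_const (j z)).sub (((hasDerivAt_slice hU hz' ht h0).neg.exp).mul
    ((hasDerivAt_slice (contDiffOn_dirD hT hU (z, 0)) hz' ht h0).add_const 1)))
  have heq := (hasDerivAt_slice hUt hz' ht h0).unique (hd.congr_of_eventuallyEq hev)
  simp only [Pi.neg_apply] at heq
  have hflowz := flow_boundary hT hj hjpos hflow ht hz
  have hnormal := dirD_normal_nonneg_of_isMaxOn hUt hz' ht (hzM ▸ hM)
  rw [dirD_comm hT hU (0, 1) (z, 0) (mk_mem_prod hz' ht), hzM] at heq
  rw [hzM] at hflowz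
  rw [heq]
  have := mul_nonneg (Real.exp_pos (-uncur u (z, t))).le hnormal
  have e : M - betaC j u ρ t * j z =
    -(Real.exp (-uncur u (z, t)) * (dirD T (z, 0) (uncur u) (z, t) + 1)) := by linarith
  rw [e]
  linarith

lemma Kcur_sub_eq (hT : 0 < T) (hf : ContinuousOn f cdisc) (hfpos : ∀ z ∈ cdisc, 0 < f z)
    (hflow : IsFlow f j T u ρ) {t : ℝ} {z : ℂ} (ht : t ∈ flowDom T) (hz : z ∈ cdisc) :
    Kcur u t z - alphaC f u ρ t * f z = -dirD T (0, 1) (uncur u) (z, t) := by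
  rw [Kcur_eq hT hflow ht hz, flow_interior hT hf hfpos hflow ht hz, uncur]
  ring

lemma kcur_sub_eq (hT : 0 < T) (hj : ContinuousOn j bdry) (hjpos : ∀ z ∈ bdry, 0 < j z)
    (hflow : IsFlow f j T u ρ) {t : ℝ} {z : ℂ} (ht : t ∈ flowDom T) (hz : z ∈ bdry) :
    kcur u t z - betaC j u ρ t * j z = -dirD T (0, 1) (uncur u) (z, t) := by
  rw [kcur, nder_eq hflow ht (bdry_subset_cdisc hz), flow_boundary hT hj hjpos hflow ht hz]
  simp only [uncur]
  ring

end Flow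

lemma abs_le_iSup_abs {A S : Set ℂ} {h : ℂ → ℝ} (hA : IsCompact A) (hh : ContinuousOn h A)
    (hS : S ⊆ A) {z : ℂ} (hz : z ∈ S) : |h z| ≤ ⨆ w : S, |h ↑w| := by
  refine le_ciSup (f := fun w : S => |h ↑w|) ((hA.bddAbove_image hh.abs).mono ?_) ⟨z, hz⟩
  rintro _ ⟨w, rfl⟩
  exact mem_image_of_mem _ (hS w.2)

/-- Lower curvature bound along the flow:
`inf_{∂B}(k − βj) ≥ inf_B(K − αf) ≥ κ` for suitable `κ < 0`. -/
theorem flow_curvature_lower_bound (f j : ℂ → ℝ)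
    (hf : ContDiffOn ℝ (⊤ : ℕ∞) f cdisc) (hfpos : ∀ z ∈ cdisc, 0 < f z)
    (hj : ContDiffOn ℝ (⊤ : ℕ∞) j bdry) (hjpos : ∀ z ∈ bdry, 0 < j z)
    (T : ℝ≥0∞) (hT : 0 < T) (u : ℂ → ℝ → ℝ) (ρ : ℝ → ℝ)
    (hflow : IsFlow f j T u ρ)
    (α₁ β₁ : ℝ)
    (hα : ∀ t ∈ flowDom T, alphaC f u ρ t ≤ α₁)
    (hβ : ∀ t ∈ flowDom T, betaC j u ρ t ≤ β₁)
    (m₀ : ℝ)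
    (hm₀ : m₀ = (1 / 2) * ballInt (fun z => Real.exp (2 * u z 0)) +
      circInt (fun z => Real.exp (u z 0)))
    (C₁ C₂ : ℝ) (hC₁pos : 0 < C₁) (hC₂pos : 0 < C₂)
    (hC₁ : ∀ t ∈ flowDom T, 0 < t →
      alphaC f u ρ t * |deriv ρ t| / ρ t * (⨆ w : cdisc, |f ↑w|) ≤ C₁ ∧
      alphaC f u ρ t ^ 2 / ρ t * (⨆ w : cdisc, |f ↑w|) ^ 2 ≤ C₁)
    (hC₂ : ∀ t ∈ flowDom T, 0 < t →
      2 * betaC j u ρ t * |deriv ρ t| / (Real.pi - ρ t) * (⨆ w : bdry, |j ↑w|) ≤ C₂ ∧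
      betaC j u ρ t ^ 2 / (Real.pi - ρ t) * (⨆ w : bdry, |j ↑w|) ^ 2 ≤ C₂)
    (κ : ℝ) (hκneg : κ < 0)
    (hκ : κ < -2 * ((⨆ w : odisc, |Kcur u 0 ↑w|) +
      α₁ * (⨆ w : cdisc, |f ↑w|) + β₁ * (⨆ w : bdry, |j ↑w|)))
    (hκ₁ : 0 < κ ^ 2 - C₁ + 2 * m₀ * C₁ * κ)
    (hκ₂ : 0 < κ ^ 2 - C₂ + 2 * m₀ * C₂ * κ) :
    ∀ t ∈ flowDom T,
      κ ≤ sInf ((fun z => Kcur u t z - alphaC f u ρ t * f z) '' odisc) ∧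
      sInf ((fun z => Kcur u t z - alphaC f u ρ t * f z) '' odisc) ≤
        sInf ((fun z => kcur u t z - betaC j u ρ t * j z) '' bdry) := by
  have hfc := hf.continuousOn
  have hjc := hj.continuousOn
  have hD := contDiffOn_dirD hT hflow.smooth (0, 1)
  have hDs : ∀ t ∈ flowDom T, ContinuousOn (fun z => dirD T (0, 1) (uncur u) (z, t)) cdisc :=
    fun t ht => isDiscIntegral_ballInt.continuousOn_slice hD.continuousOn ht
  have hfle : ∀ z ∈ cdisc, f z ≤ ⨆ w : cdisc, |f ↑w| := fun z hz =>
    (le_abs_self _).trans (abs_le_iSup_abs isCompact_cdisc hfc subset_rfl hz)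
  have hjle : ∀ z ∈ bdry, j z ≤ ⨆ w : bdry, |j ↑w| := fun z hz =>
    (le_abs_self _).trans (abs_le_iSup_abs isCompact_bdry hjc subset_rfl hz)
  have hT0 := zero_mem_flowDom hT
  have hKc : ContinuousOn (Kcur u 0) cdisc :=
    ((hDs 0 hT0).neg.add (continuousOn_const.mul hfc)).congr fun z hz =>
      sub_eq_iff_eq_add.1 (Kcur_sub_eq hT hfc hfpos hflow hT0 hz)
  have hKle : ∀ z ∈ odisc, |Kcur u 0 z| ≤ ⨆ w : odisc, |Kcur u 0 ↑w| := fun z hz =>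
    abs_le_iSup_abs isCompact_cdisc hKc odisc_subset_cdisc hz
  have hαf : ∀ t ∈ flowDom T, ∀ z ∈ cdisc,
      0 ≤ alphaC f u ρ t * f z ∧ alphaC f u ρ t * f z ≤ α₁ * ⨆ w : cdisc, |f ↑w| :=
    fun t ht z hz => by
      have ha := alphaC_pos hfc hfpos hflow ht
      exact ⟨mul_nonneg ha.le (hfpos z hz).le, mul_le_mul (hα t ht) (hfle z hz) (hfpos z hz).le
        (ha.le.trans (hα t ht))⟩
  have hβj : ∀ t ∈ flowDom T, ∀ z ∈ bdry,
      0 ≤ betaC j u ρ t * j z ∧ betaC j u ρ t * j z ≤ β₁ * ⨆ w : bdry, |j ↑w| :=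
    fun t ht z hz => by
      have hb := betaC_pos hjc hjpos hflow ht
      exact ⟨mul_nonneg hb.le (hjpos z hz).le, mul_le_mul (hβ t ht) (hjle z hz) (hjpos z hz).le
        (hb.le.trans (hβ t ht))⟩
  have hK0 := (abs_nonneg _).trans (hKle 0 (by simp [odisc]))
  have hf0 := (hαf 0 hT0 0 (by simp [cdisc])).1.trans (hαf 0 hT0 0 (by simp [cdisc])).2
  have hj0 := (hβj 0 hT0 1 (by simp [bdry])).1.trans (hβj 0 hT0 1 (by simp [bdry])).2
  have hm₀' : m₀ = (1 / 2) * (ballInt fun z => Real.exp (2 * uncur u (z, 0))) +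
      circInt fun z => Real.exp (1 * uncur u (z, 0)) := by
    simpa only [uncur, one_mul] using hm₀
  have hinit : ∀ z ∈ cdisc, dirD T (0, 1) (uncur u) (z, 0) < -κ := by
    intro z hz
    have hle : dirD T (0, 1) (uncur u) (z, 0) ≤
        (⨆ w : odisc, |Kcur u 0 ↑w|) + α₁ * ⨆ w : cdisc, |f ↑w| := by
      have hc := hDs 0 hT0
      rw [← closure_odisc] at hc hz
      refine le_on_closure (fun w hw => ?_) hc continuousOn_const hz
      have hw' := odisc_subset_cdisc hw
      linarith [Kcur_sub_eq hT hfc hfpos hflow hT0 hw', hKle w hw, (hαf 0 hT0 w hw').2,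
        neg_abs_le (Kcur u 0 w)]
    linarith
  have key : ∀ t ∈ flowDom T, ∀ z ∈ cdisc, dirD T (0, 1) (uncur u) (z, t) < -κ := by
    by_contra! hcon
    obtain ⟨t₁, ht₁, z₁, hz₁, hge⟩ := hcon
    obtain ⟨z, hz, t, ht, h0, hzM, hle⟩ :=
      exists_first_touching hD.continuousOn hinit hz₁ ht₁ hge
    have hM : ∀ w ∈ cdisc, dirD T (0, 1) (uncur u) (w, t) ≤ -κ := fun w hw =>
      hle w hw t ⟨h0.le, le_rfl⟩
    have htime := dirD_time_nonneg_of_isMaxOn hD hz ht h0 fun s hs => hzM ▸ hle z hz s hs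
    have hκ0 : 0 ≤ -κ := by linarith
    rcases mem_odisc_or_mem_bdry hz with hzo | hzb
    · obtain ⟨a, ha, hbound⟩ := exists_hasDerivAt_alphaC hT hfc hfpos hjc hjpos hflow hm₀' ht h0
        hfle hκ0 hM (hC₁ t ht h0).1 (hC₁ t ht h0).2
      have h1 := dirD_time_le_of_interior_max hT hfc hfpos hflow ht h0 hzo hM hzM ha
      have h2 : alphaC f u ρ t * f z ≤ -κ / 2 := by linarith [(hαf t ht z hz).2]
      nlinarith [hbound z hz, mul_le_mul_of_nonneg_left h2 hκ0]
    · obtain ⟨b, hb, hbound⟩ := exists_hasDerivAt_betaC hT hfc hfpos hjc hjpos hflow hm₀' ht h0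
        hjle hκ0 hM (hC₂ t ht h0).1 (hC₂ t ht h0).2
      have h1 := dirD_time_le_of_boundary_max hT hjc hjpos hflow ht h0 hzb hM hzM hb
      have h2 : betaC j u ρ t * j z ≤ -κ / 2 := by linarith [(hβj t ht z hzb).2]
      nlinarith [hbound z hzb, mul_le_mul_of_nonneg_left h2 hκ0]
  intro t ht
  have hlow : ∀ y ∈ (fun z => Kcur u t z - alphaC f u ρ t * f z) '' odisc, κ ≤ y := by
    rintro _ ⟨z, hz, rfl⟩
    have hz' := odisc_subset_cdisc hz
    simp only [Kcur_sub_eq hT hfc hfpos hflow ht hz']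
    linarith [key t ht z hz']
  refine ⟨le_csInf (Set.Nonempty.image _ ⟨0, by simp [odisc]⟩) hlow,
    le_csInf (Set.Nonempty.image _ ⟨1, by simp [bdry]⟩) ?_⟩
  rintro _ ⟨z, hz, rfl⟩
  simp only [kcur_sub_eq hT hjc hjpos hflow ht hz]
  have hc : ContinuousOn (fun w => -dirD T (0, 1) (uncur u) (w, t)) cdisc := (hDs t ht).neg
  have hz' := bdry_subset_cdisc hz
  rw [← closure_odisc] at hc hz'
  refine le_on_closure (fun w hw => ?_) continuousOn_const hc hz'
  rw [← Kcur_sub_eq hT hfc hfpos hflow ht (odisc_subset_cdisc hw)]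
  exact csInf_le ⟨κ, hlow⟩ (mem_image_of_mem _ hw)
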